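/- arXiv:2511.09703 — 8 statements merged into one kernel-verified Lean document; each statement's English description precedes it below -/
import Mathlib

section
/- Let u ∈ Σ* be a word of minimum rank, and let r := rank_un(M). Then there exist pairwise disjoint sets C_1, …, C_r ⊆ Q and pairwise disjoint sets R_1, …, R_r ⊆ Q such that M(u) = Σ_{i=1}^r [C_i][R_i]^T; moreover each [C_i] is a maximal column and each [R_i]^T is a maximal row. -/
open Matrix

/-- Indicator (0/1) column vector of a set of states: `ind S q = 1` iff `q ∈ S`. -/
noncomputable def ind {Q : Type*} (S : Set Q) : Q → ℝ := S.indicator 1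

namespace UFA

variable {Q σ : Type*}

/-- `y` is a column of the monoid morphism `M`, i.e. `y = M(w)[q]` for some word `w`, state `q`. -/
def IsCol (M : List σ → Matrix Q Q ℝ) (y : Q → ℝ) : Prop :=
  ∃ w : List σ, ∃ q : Q, y = fun p => M w p q

/-- `x` is a row of `M`, i.e. `xᵀ = [q]ᵀ M(w)` for some word `w` and state `q`. -/
def IsRow (M : List σ → Matrix Q Q ℝ) (x : Q → ℝ) : Prop :=
  ∃ w : List σ, ∃ q : Q, x = fun p => M w q p

/-- A maximal column: a column `y` such that no column `y' ≠ y` satisfies `y' ≥ y`. -/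
def IsMaxCol (M : List σ → Matrix Q Q ℝ) (y : Q → ℝ) : Prop :=
  IsCol M y ∧ ∀ y', IsCol M y' → y ≤ y' → y' = y

/-- A maximal row: a row `x` such that no row `x' ≠ x` satisfies `x' ≥ x`. -/
def IsMaxRow (M : List σ → Matrix Q Q ℝ) (x : Q → ℝ) : Prop :=
  IsRow M x ∧ ∀ x', IsRow M x' → x ≤ x' → x' = x

/-- Unambiguous rank of a zero-one matrix: the least `r` such that `A = C * R` with `C, R`
zero-one matrices having `r` columns resp. `r` rows. -/
noncomputable def rankUnMat (A : Matrix Q Q ℝ) : ℕ :=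
  sInf {r : ℕ | ∃ C : Matrix Q (Fin r) ℝ, ∃ R : Matrix (Fin r) Q ℝ,
    (∀ i j, C i j = 0 ∨ C i j = 1) ∧ (∀ i j, R i j = 0 ∨ R i j = 1) ∧ A = C * R}

/-- Minimum unambiguous rank of the matrix monoid generated by `M`. -/
noncomputable def rankUn (M : List σ → Matrix Q Q ℝ) : ℕ :=
  sInf (Set.range fun w => rankUnMat (M w))

/-- Minimum real rank of the matrix monoid generated by `M`. -/
noncomputable def rankReal [Fintype Q] (M : List σ → Matrix Q Q ℝ) : ℕ :=
  sInf (Set.range fun w => (M w).rank)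

/-- `Mer M q`: the set of states that appear together with `q` in some column. -/
def Mer (M : List σ → Matrix Q Q ℝ) (q : Q) : Set Q :=
  {q' | ∃ S : Set Q, q ∈ S ∧ q' ∈ S ∧ IsCol M (ind S)}

end UFA

/-- All entries of the matrix are zero or one. -/
def IsZeroOne {m n : Type*} (A : Matrix m n ℝ) : Prop := ∀ i j, A i j = 0 ∨ A i j = 1

/-- The matrix is the `0/1` matrix of a permutation. -/
def IsPermMatrix {ι : Type*} [DecidableEq ι] (A : Matrix ι ι ℝ) : Prop :=
  ∃ τ : Equiv.Perm ι, ∀ k i, A k i = if τ k = i then 1 else 0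

namespace IsZeroOne

variable {m n : Type*} {A : Matrix m n ℝ}

theorem nonneg (hA : IsZeroOne A) (i : m) (j : n) : 0 ≤ A i j := by
  rcases hA i j with h | h <;> simp [h]

theorem le_one (hA : IsZeroOne A) (i : m) (j : n) : A i j ≤ 1 := by
  rcases hA i j with h | h <;> simp [h]

theorem ind_col (hA : IsZeroOne A) (j : n) : ind {i | A i j = 1} = fun i => A i j := by
  funext i
  rcases hA i j with h | h <;> simp [ind, Set.indicator, h]

theorem ind_row (hA : IsZeroOne A) (i : m) : ind {j | A i j = 1} = fun j => A i j := by
  funext j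
  rcases hA i j with h | h <;> simp [ind, Set.indicator, h]

theorem exists_nat (hA : IsZeroOne A) (i : m) (j : n) : ∃ a : ℕ, (a : ℝ) = A i j := by
  rcases hA i j with h | h
  · exact ⟨0, by simp [h]⟩
  · exact ⟨1, by simp [h]⟩

theorem of_nat_of_le_one (hA : ∀ i j, ∃ a : ℕ, (a : ℝ) = A i j) (h1 : ∀ i j, A i j ≤ 1) :
    IsZeroOne A := by
  intro i j
  obtain ⟨a, ha⟩ := hA i j
  have h := h1 i j
  rw [← ha] at h ⊢
  have : a ≤ 1 := by exact_mod_cast h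
  interval_cases a <;> simp

end IsZeroOne

theorem Matrix.exists_nat_mul {l m n : Type*} [Fintype m] {A : Matrix l m ℝ} {B : Matrix m n ℝ}
    (hA : ∀ i j, ∃ a : ℕ, (a : ℝ) = A i j) (hB : ∀ i j, ∃ a : ℕ, (a : ℝ) = B i j) (i : l) (k : n) :
    ∃ a : ℕ, (a : ℝ) = (A * B) i k := by
  choose f hf using hA
  choose g hg using hB
  refine ⟨∑ j, f i j * g j k, ?_⟩
  simp [Matrix.mul_apply, hf, hg]

theorem Matrix.mul_apply_nonneg {l m n : Type*} [Fintype m] {A : Matrix l m ℝ} {B : Matrix m n ℝ}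
    (hA : ∀ i j, 0 ≤ A i j) (hB : ∀ i j, 0 ≤ B i j) (i : l) (k : n) : 0 ≤ (A * B) i k := by
  rw [Matrix.mul_apply]
  exact Finset.sum_nonneg fun j _ => mul_nonneg (hA i j) (hB j k)

theorem Matrix.mul_le_mul_apply {l m n : Type*} [Fintype m] {A : Matrix l m ℝ} {B : Matrix m n ℝ}
    (hA : ∀ i j, 0 ≤ A i j) (hB : ∀ i j, 0 ≤ B i j) (i : l) (j : m) (k : n) :
    A i j * B j k ≤ (A * B) i k := by
  rw [Matrix.mul_apply]
  exact Finset.single_le_sum (f := fun j => A i j * B j k)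
    (fun j _ => mul_nonneg (hA i j) (hB j k)) (Finset.mem_univ j)

theorem Matrix.exists_ne_zero_of_mul_apply_ne_zero {l m n : Type*} [Fintype m]
    {A : Matrix l m ℝ} {B : Matrix m n ℝ} {i : l} {k : n} (h : (A * B) i k ≠ 0) :
    ∃ j, A i j ≠ 0 ∧ B j k ≠ 0 := by
  rw [Matrix.mul_apply] at h
  obtain ⟨j, -, hj⟩ := Finset.exists_ne_zero_of_sum_ne_zero h
  exact ⟨j, left_ne_zero_of_mul hj, right_ne_zero_of_mul hj⟩

/-- A zero-one matrix with an entrywise nonnegative inverse is a permutation matrix. -/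
theorem IsZeroOne.isPermMatrix_of_inverse {ι : Type*} [Fintype ι] [DecidableEq ι]
    {A B : Matrix ι ι ℝ} (hA : IsZeroOne A) (hB : ∀ i j, 0 ≤ B i j) (hAB : A * B = 1)
    (hBA : B * A = 1) : IsPermMatrix A := by
  have eq_of_left {i k j : ι} (h1 : A i k ≠ 0) (h2 : B k j ≠ 0) : i = j := by
    by_contra hne
    have h := Matrix.mul_le_mul_apply hA.nonneg hB i k j
    rw [hAB, Matrix.one_apply_ne hne] at h
    exact absurd h (not_le.2 (mul_pos ((hA.nonneg _ _).lt_of_ne' h1) ((hB _ _).lt_of_ne' h2)))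
  have eq_of_right {i k j : ι} (h1 : B i k ≠ 0) (h2 : A k j ≠ 0) : i = j := by
    by_contra hne
    have h := Matrix.mul_le_mul_apply hB hA.nonneg i k j
    rw [hBA, Matrix.one_apply_ne hne] at h
    exact absurd h (not_le.2 (mul_pos ((hB _ _).lt_of_ne' h1) ((hA.nonneg _ _).lt_of_ne' h2)))
  have hex (i : ι) : ∃ k, A i k ≠ 0 ∧ B k i ≠ 0 :=
    Matrix.exists_ne_zero_of_mul_apply_ne_zero (by simp [hAB])
  choose f hf hf' using hex
  have hinj : Function.Injective f := fun i j hij => eq_of_left (hf i) (hij ▸ hf' j)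
  refine ⟨Equiv.ofBijective f (Finite.injective_iff_bijective.1 hinj), fun k i => ?_⟩
  rw [Equiv.ofBijective_apply]
  split_ifs with h
  · exact (hA k i).resolve_left (h ▸ hf k)
  · exact (hA k i).resolve_right fun h1 => h (eq_of_right (hf' k) (by simp [h1]))

/-- Some positive power of a matrix is idempotent if all its positive powers are zero-one. -/
theorem Matrix.exists_isIdempotentElem_pow {ι : Type*} [Fintype ι] [DecidableEq ι]
    {A : Matrix ι ι ℝ} (hA : ∀ n : ℕ, IsZeroOne (A ^ (n + 1))) :
    ∃ n : ℕ, IsIdempotentElem (A ^ (n + 1)) := by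
  have hfin : {B : Matrix ι ι ℝ | ∀ i, B i ∈ {v : ι → ℝ | ∀ j, v j ∈ ({0, 1} : Set ℝ)}}.Finite :=
    Set.Finite.pi' fun _ => Set.Finite.pi' fun _ => Set.toFinite _
  have := hfin.to_subtype
  obtain ⟨a, b, hab, h⟩ := Finite.exists_ne_map_eq_of_infinite
    (fun n : ℕ => (⟨A ^ (n + 1), fun i j => hA n i j⟩ :
      {B : Matrix ι ι ℝ | ∀ i, B i ∈ {v : ι → ℝ | ∀ j, v j ∈ ({0, 1} : Set ℝ)}}))
  replace h : A ^ (a + 1) = A ^ (b + 1) := congrArg Subtype.val h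
  wlog hlt : a < b generalizing a b
  · exact this b a hab.symm h.symm (by omega)
  obtain ⟨d, rfl⟩ := Nat.exists_eq_add_of_lt hlt
  have hper (n m : ℕ) : A ^ (a + 1 + n) = A ^ (a + 1 + n + m * (d + 1)) := by
    induction m with
    | zero => simp
    | succ m ih =>
      rw [ih, show a + 1 + n + (m + 1) * (d + 1) = a + d + 1 + 1 + (n + m * (d + 1)) by ring,
        pow_add _ (a + d + 1 + 1), ← h, ← pow_add]
      congr 1
      ring
  refine ⟨(a + 1) * (d + 1) - 1, ?_⟩
  have hpos : 0 < (a + 1) * (d + 1) := by positivity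
  rw [Nat.sub_add_cancel hpos, IsIdempotentElem, ← pow_add]
  have := hper ((a + 1) * d) (a + 1)
  rw [show a + 1 + (a + 1) * d = (a + 1) * (d + 1) by ring] at this
  exact this.symm

namespace UFA

variable {Q σ ι : Type*}

theorem rankUnMat_le [Fintype ι] {A : Matrix Q Q ℝ} {C : Matrix Q ι ℝ} {R : Matrix ι Q ℝ}
    (hC : IsZeroOne C) (hR : IsZeroOne R) (h : A = C * R) : rankUnMat A ≤ Fintype.card ι := by
  let e := (Fintype.equivFin ι).symm
  refine Nat.sInf_le ⟨C.submatrix id e, R.submatrix e id, fun _ _ => hC _ _, fun _ _ => hR _ _, ?_⟩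
  rw [Matrix.submatrix_mul_equiv, ← h, Matrix.submatrix_id_id]

theorem exists_rankUnMat_factorization [Fintype Q] {A : Matrix Q Q ℝ} (hA : IsZeroOne A) :
    ∃ (C : Matrix Q (Fin (rankUnMat A)) ℝ) (R : Matrix (Fin (rankUnMat A)) Q ℝ),
      IsZeroOne C ∧ IsZeroOne R ∧ A = C * R := by
  classical
  let e := (Fintype.equivFin Q).symm
  refine Nat.sInf_mem (s := {r : ℕ | ∃ C : Matrix Q (Fin r) ℝ, ∃ R : Matrix (Fin r) Q ℝ,
    (∀ i j, C i j = 0 ∨ C i j = 1) ∧ (∀ i j, R i j = 0 ∨ R i j = 1) ∧ A = C * R}) ?_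
  refine ⟨Fintype.card Q, A.submatrix id e, (1 : Matrix Q Q ℝ).submatrix e id,
    fun _ _ => hA _ _, fun i j => ?_, ?_⟩
  · by_cases h : e i = j <;> simp [Matrix.one_apply, h]
  · rw [Matrix.submatrix_mul_equiv, mul_one, Matrix.submatrix_id_id]

theorem exists_eq_one_of_card_le_rankUnMat [Fintype ι] [DecidableEq ι] {A : Matrix Q Q ℝ}
    {C : Matrix Q ι ℝ} {R : Matrix ι Q ℝ} (hC : IsZeroOne C) (hR : IsZeroOne R) (h : A = C * R)
    (hA : Fintype.card ι ≤ rankUnMat A) (i : ι) : (∃ p, C p i = 1) ∧ ∃ q, R i q = 1 := by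
  have key (hi : ∀ p q, C p i * R i q = 0) : False := by
    have hle := rankUnMat_le (A := A) (ι := {j // j ≠ i}) (C := C.submatrix id Subtype.val)
      (R := R.submatrix Subtype.val id) (fun _ _ => hC _ _) (fun _ _ => hR _ _) (by
        ext p q
        rw [h, Matrix.mul_apply, Matrix.mul_apply, Fintype.sum_eq_add_sum_subtype_ne _ i, hi,
          zero_add]
        rfl)
    have := Fintype.card_subtype_lt (p := fun j => j ≠ i) (x := i) (by simp)
    omega
  constructor
  · by_contra! hne
    exact key fun p q => by rw [(hC p i).resolve_right (hne p), zero_mul]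
  · by_contra! hne
    exact key fun p q => by rw [(hR i q).resolve_right (hne q), mul_zero]

section Columns

variable [Fintype Q] [DecidableEq ι] {M : List σ → Matrix Q Q ℝ} {C : Matrix Q ι ℝ} {R : Matrix ι Q ℝ}

theorem col_disjoint (hUn : ∀ w, IsZeroOne (M w)) (hSC : ∀ p q : Q, ∃ w, M w p q = 1)
    (hC : IsZeroOne C) (hR : IsZeroOne R) (hR1 : ∀ i, ∃ q, R i q = 1)
    (hN : ∀ w, IsPermMatrix (R * M w * C)) {p : Q} {i j : ι} (hi : C p i = 1) (hj : C p j = 1) :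
    i = j := by
  obtain ⟨t, ht⟩ := hR1 i
  obtain ⟨w, hw⟩ := hSC t p
  obtain ⟨τ, hτ⟩ := hN w
  have h1 : 1 ≤ (R * M w) i p := by
    simpa [ht, hw] using Matrix.mul_le_mul_apply hR.nonneg (hUn w).nonneg i t p
  have key (l : ι) (hl : C p l = 1) : τ i = l := by
    have h2 := Matrix.mul_le_mul_apply (Matrix.mul_apply_nonneg hR.nonneg (hUn w).nonneg)
      hC.nonneg i p l
    rw [hl, mul_one, hτ] at h2
    by_contra hne
    rw [if_neg hne] at h2
    linarith
  rw [← key i hi, ← key j hj]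

theorem isMaxCol [Fintype ι] (hMm : ∀ u v, M (u ++ v) = M u * M v) (hUn : ∀ w, IsZeroOne (M w))
    (hSC : ∀ p q : Q, ∃ w, M w p q = 1) (hC : IsZeroOne C) (hR : IsZeroOne R)
    (hC1 : ∀ i, ∃ p, C p i = 1) (hR1 : ∀ i, ∃ q, R i q = 1)
    (hN : ∀ w, IsPermMatrix (R * M w * C))
    (hdisj : ∀ {q i j}, R i q = 1 → R j q = 1 → i = j) {u : List σ} (hu : M u = C * R) (i : ι) :
    IsMaxCol M fun p => C p i := by
  classical
  obtain ⟨t, ht⟩ := hR1 i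
  refine ⟨⟨u, t, ?_⟩, ?_⟩
  · funext p
    rw [hu, Matrix.mul_apply, Finset.sum_eq_single i, ht, mul_one]
    · intro j _ hj
      rw [(hR j t).resolve_right fun h => hj (hdisj h ht), mul_zero]
    · simp
  rintro _ ⟨v, q, rfl⟩ hle
  funext p
  have hlep : ∀ s, C s i ≤ M v s q := hle
  rcases hC p i with hp | hp
  swap
  · exact le_antisymm (by rw [hp]; exact (hUn v).le_one p q) (hlep p)
  rw [hp]
  by_contra hpq
  replace hpq : M v p q = 1 := (hUn v p q).resolve_left hpq
  obtain ⟨w, hw⟩ := hSC t p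
  obtain ⟨p', hp'⟩ := hC1 i
  obtain ⟨y, hy⟩ := hSC q p'
  obtain ⟨τ, hτ⟩ := hN w
  obtain ⟨τ', hτ'⟩ := hN (w ++ (v ++ y))
  have hRw := Matrix.mul_apply_nonneg hR.nonneg (hUn w).nonneg
  have hyC : 1 ≤ (M y * C) q i := by
    simpa [hy, hp'] using Matrix.mul_le_mul_apply (hUn y).nonneg hC.nonneg q p' i
  have upper (a : ι) : (R * M w * M v) a q ≤ if τ' a = i then 1 else 0 := by
    rw [← hτ', hMm, hMm, show R * (M w * (M v * M y)) * C = (R * M w * M v) * (M y * C) by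
      simp only [Matrix.mul_assoc]]
    have hnn := Matrix.mul_apply_nonneg hRw (hUn v).nonneg
    exact (le_mul_of_one_le_right (hnn a q) hyC).trans
      (Matrix.mul_le_mul_apply hnn (Matrix.mul_apply_nonneg (hUn y).nonneg hC.nonneg) a q i)
  have lower (a : ι) : (if τ a = i then 1 else 0) + (R * M w) a p ≤ (R * M w * M v) a q := by
    rw [← hτ, Matrix.mul_apply, Matrix.mul_apply (M := R * M w) (N := M v),
      show (R * M w) a p = ∑ s, (R * M w) a s * if s = p then 1 else 0 by simp,
      ← Finset.sum_add_distrib]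
    refine Finset.sum_le_sum fun s _ => ?_
    rw [← mul_add]
    refine mul_le_mul_of_nonneg_left ?_ (hRw a s)
    split_ifs with hs
    · rw [hs, hp, hpq, zero_add]
    · rw [add_zero]
      exact hlep s
  have h1 : 1 ≤ (R * M w) i p := by
    simpa [ht, hw] using Matrix.mul_le_mul_apply hR.nonneg (hUn w).nonneg i t p
  have hτ'i : τ' i = i := by
    by_contra hne
    have h2 := upper i
    have h3 := lower i
    rw [if_neg hne] at h2
    split_ifs at h3 <;> linarith
  have hτ'k : τ' (τ.symm i) = i := by
    by_contra hne
    have h2 := upper (τ.symm i)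
    have h3 := lower (τ.symm i)
    rw [if_neg hne] at h2
    rw [if_pos (τ.apply_symm_apply i)] at h3
    linarith [hRw (τ.symm i) p]
  have hτi : τ i = i := by
    rw [← hτ'k.trans hτ'i.symm |> τ'.injective, τ.apply_symm_apply,
      hτ'k.trans hτ'i.symm |> τ'.injective]
  have h2 := upper i
  have h3 := lower i
  rw [if_pos hτ'i] at h2
  rw [if_pos hτi] at h3
  linarith

end Columns

theorem isPermMatrix_of_minimal_rank [Fintype Q] [Fintype ι] [DecidableEq ι]
    {M : List σ → Matrix Q Q ℝ} {C : Matrix Q ι ℝ} {R : Matrix ι Q ℝ}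
    (hMm : ∀ u v, M (u ++ v) = M u * M v) (hUn : ∀ w, IsZeroOne (M w))
    (hmin : ∀ w, Fintype.card ι ≤ rankUnMat (M w))
    (hC : IsZeroOne C) (hR : IsZeroOne R)
    (hC1 : ∀ i, ∃ p, C p i = 1) (hR1 : ∀ i, ∃ q, R i q = 1)
    {u : List σ} (hu : M u = C * R) (w : List σ) : IsPermMatrix (R * M w * C) := by
  have huxu (x : List σ) : M (u ++ (x ++ u)) = C * (R * M x * C) * R := by
    simp only [hMm, hu, Matrix.mul_assoc]
  have nat (x : List σ) := Matrix.exists_nat_mul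
    (Matrix.exists_nat_mul hR.exists_nat (hUn x).exists_nat) hC.exists_nat
  have nonneg (x : List σ) :=
    Matrix.mul_apply_nonneg (Matrix.mul_apply_nonneg hR.nonneg (hUn x).nonneg) hC.nonneg
  have left (x : List σ) : IsZeroOne (C * (R * M x * C)) := by
    refine IsZeroOne.of_nat_of_le_one (Matrix.exists_nat_mul hC.exists_nat (nat x)) fun p j => ?_
    obtain ⟨q, hq⟩ := hR1 j
    have h := Matrix.mul_le_mul_apply (Matrix.mul_apply_nonneg hC.nonneg (nonneg x))
      hR.nonneg p j q
    rw [hq, mul_one, ← huxu] at h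
    exact h.trans ((hUn _).le_one p q)
  have right (x : List σ) : IsZeroOne ((R * M x * C) * R) := by
    refine IsZeroOne.of_nat_of_le_one (Matrix.exists_nat_mul (nat x) hR.exists_nat) fun i q => ?_
    obtain ⟨p, hp⟩ := hC1 i
    have h := Matrix.mul_le_mul_apply hC.nonneg (Matrix.mul_apply_nonneg (nonneg x) hR.nonneg)
      p i q
    rw [hp, one_mul, ← Matrix.mul_assoc, ← huxu] at h
    exact h.trans ((hUn _).le_one p q)
  have zeroOne (x : List σ) : IsZeroOne (R * M x * C) := by
    refine IsZeroOne.of_nat_of_le_one (nat x) fun i j => ?_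
    obtain ⟨p, hp⟩ := hC1 i
    have h := Matrix.mul_le_mul_apply hC.nonneg (nonneg x) p i j
    rw [hp, one_mul] at h
    exact h.trans ((left x).le_one p j)
  have pow (n : ℕ) : ∃ x, (R * M w * C) ^ (n + 1) = R * M x * C := by
    induction n with
    | zero => exact ⟨w, by simp⟩
    | succ n ih =>
      obtain ⟨x, hx⟩ := ih
      exact ⟨x ++ (u ++ w), by rw [pow_succ, hx]; simp only [hMm, hu, Matrix.mul_assoc]⟩
  have pow_zeroOne (n : ℕ) : IsZeroOne ((R * M w * C) ^ (n + 1)) := by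
    obtain ⟨x, hx⟩ := pow n
    exact hx ▸ zeroOne x
  obtain ⟨n, he⟩ := Matrix.exists_isIdempotentElem_pow pow_zeroOne
  have hone : (R * M w * C) ^ (n + 1) = 1 := by
    obtain ⟨x, hx⟩ := pow n
    rw [hx] at he ⊢
    have hZ := zeroOne x
    have hL := left x
    have hR' := right x
    have hux := huxu x
    generalize R * M x * C = e at *
    have two {i j k l : ι} (hik : e i k = 1) (hkj : e k j = 1) (hil : e i l = 1)
        (hlj : e l j = 1) : k = l := by
      by_contra hne
      have h : ∑ s ∈ {k, l}, e i s * e s j ≤ (e * e) i j := by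
        rw [Matrix.mul_apply]
        exact Finset.sum_le_sum_of_subset_of_nonneg (Finset.subset_univ _)
          fun s _ _ => mul_nonneg (hZ.nonneg _ _) (hZ.nonneg _ _)
      rw [Finset.sum_pair hne, hik, hkj, hil, hlj, he.eq] at h
      linarith [hZ.le_one i j]
    have trans {i j k : ι} (h1 : e i k = 1) (h2 : e k j = 1) : e i j = 1 := by
      have h := Matrix.mul_le_mul_apply hZ.nonneg hZ.nonneg i k j
      rw [h1, h2, he.eq] at h
      exact le_antisymm (hZ.le_one i j) (by linarith)
    have split {i j : ι} (h : e i j = 1) : ∃ k, e i k = 1 ∧ e k j = 1 := by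
      obtain ⟨k, h1, h2⟩ := Matrix.exists_ne_zero_of_mul_apply_ne_zero (A := e) (B := e)
        (i := i) (k := j) (by rw [he.eq, h]; exact one_ne_zero)
      exact ⟨k, (hZ _ _).resolve_left h1, (hZ _ _).resolve_left h2⟩
    have fixed {i j k : ι} (h1 : e i k = 1) (h2 : e k j = 1) : e k k = 1 := by
      obtain ⟨s, h3, h4⟩ := split h2
      have : k = s := two h1 h2 (trans h1 h3) h4
      rwa [← this] at h3
    have hfac : M (u ++ (x ++ u)) =
        ((C * e).submatrix id (Subtype.val : {s // e s s = 1} → ι)) *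
          ((e * R).submatrix (Subtype.val : {s // e s s = 1} → ι) id) := by
      have hee : e = e.submatrix id (Subtype.val : {s // e s s = 1} → ι) *
          e.submatrix (Subtype.val : {s // e s s = 1} → ι) id := by
        ext i j
        conv_lhs => rw [← he.eq]
        rw [Matrix.mul_apply, Matrix.mul_apply]
        rw [← Fintype.sum_subtype_add_sum_subtype (fun s => e s s = 1)]
        refine add_eq_left.2 (Finset.sum_eq_zero fun s _ => ?_)
        rcases hZ i s with h1 | h1
        · rw [h1, zero_mul]
        · rw [(hZ s j).resolve_right fun h2 => s.2 (fixed h1 h2), mul_zero]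
      rw [hux]
      conv_lhs => rw [hee]
      ext p q
      rw [← Matrix.mul_assoc, Matrix.mul_assoc]
      rfl
    have hall (i : ι) : e i i = 1 := by
      by_contra hi
      have h1 := rankUnMat_le (fun _ _ => hL _ _) (fun _ _ => hR' _ _) hfac
      have h2 := Fintype.card_subtype_lt (p := fun s => e s s = 1) hi
      have h3 := hmin (u ++ (x ++ u))
      omega
    ext i j
    by_cases hij : i = j
    · rw [hij, hall, Matrix.one_apply_eq]
    · rw [Matrix.one_apply_ne hij]
      exact (hZ i j).resolve_right fun h => hij (two (hall i) h h (hall j))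
  refine (zeroOne w).isPermMatrix_of_inverse (B := (R * M w * C) ^ n) ?_
    (by rw [← pow_succ', hone]) (by rw [← pow_succ, hone])
  cases n with
  | zero =>
    intro i j
    by_cases hij : i = j <;> simp [hij]
  | succ n => exact (pow_zeroOne n).nonneg

end UFA

theorem IsPermMatrix.transpose {ι : Type*} [DecidableEq ι] {A : Matrix ι ι ℝ}
    (hA : IsPermMatrix A) : IsPermMatrix Aᵀ := by
  obtain ⟨τ, hτ⟩ := hA
  refine ⟨τ.symm, fun k i => ?_⟩
  rw [Matrix.transpose_apply, hτ]
  exact if_congr (by rw [Equiv.symm_apply_eq, eq_comm]) rfl rfl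


theorem cesari_decomposition {Q σ : Type*} [Fintype Q] [DecidableEq Q] [Nonempty Q]
    [Fintype σ] [Nonempty σ]
    (M : List σ → Matrix Q Q ℝ)
    (hM0 : M [] = 1) (hMm : ∀ u v, M (u ++ v) = M u * M v)
    (hUn : ∀ w i j, M w i j = 0 ∨ M w i j = 1)
    (hComp : ∀ w, M w ≠ 0)
    (hSC : ∀ p q : Q, ∃ w, M w p q = 1)
    (u : List σ) (hu : UFA.rankUnMat (M u) = UFA.rankUn M) :
    ∃ C R : Fin (UFA.rankUn M) → Set Q,
      (∀ i j, i ≠ j → Disjoint (C i) (C j)) ∧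
      (∀ i j, i ≠ j → Disjoint (R i) (R j)) ∧
      M u = ∑ i, Matrix.vecMulVec (ind (C i)) (ind (R i)) ∧
      (∀ i, UFA.IsMaxCol M (ind (C i))) ∧
      (∀ i, UFA.IsMaxRow M (ind (R i))) := by
  have hmin (w : List σ) : UFA.rankUn M ≤ UFA.rankUnMat (M w) := Nat.sInf_le ⟨w, rfl⟩
  obtain ⟨C, R, hC, hR, hCR⟩ : ∃ (C : Matrix Q (Fin (UFA.rankUn M)) ℝ)
      (R : Matrix (Fin (UFA.rankUn M)) Q ℝ), IsZeroOne C ∧ IsZeroOne R ∧ M u = C * R :=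
    hu ▸ UFA.exists_rankUnMat_factorization (hUn u)
  have hne := UFA.exists_eq_one_of_card_le_rankUnMat hC hR hCR (by simp [hu])
  have hC1 (i) := (hne i).1
  have hR1 (i) := (hne i).2
  have hN := UFA.isPermMatrix_of_minimal_rank hMm hUn (fun w => by simpa using hmin w)
    hC hR hC1 hR1 hCR
  let M' : List σ → Matrix Q Q ℝ := fun w => (M w.reverse)ᵀ
  have hMm' (v w) : M' (v ++ w) = M' v * M' w := by
    simp [M', hMm, Matrix.transpose_mul]
  have hUn' (w) : IsZeroOne (M' w) := fun i j => hUn _ j i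
  have hSC' (p q) : ∃ w, M' w p q = 1 := by
    obtain ⟨w, hw⟩ := hSC q p
    exact ⟨w.reverse, by simpa [M'] using hw⟩
  have hC' : IsZeroOne Cᵀ := fun i j => hC j i
  have hR' : IsZeroOne Rᵀ := fun i j => hR j i
  have hN' (w) : IsPermMatrix (Cᵀ * M' w * Rᵀ) := by
    simpa [M', Matrix.transpose_mul, Matrix.mul_assoc] using (hN w.reverse).transpose
  have hCR' : M' u.reverse = Rᵀ * Cᵀ := by
    simp [M', hCR, Matrix.transpose_mul]
  have hCd {q i j} : C q i = 1 → C q j = 1 → i = j :=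
    UFA.col_disjoint hUn hSC hC hR hR1 hN
  have hRd {q i j} : R i q = 1 → R j q = 1 → i = j :=
    UFA.col_disjoint hUn' hSC' hR' hC' hC1 hN'
  refine ⟨fun i => {p | C p i = 1}, fun i => {q | R i q = 1}, ?_, ?_, ?_, ?_, ?_⟩
  · exact fun i j hij => Set.disjoint_left.2 fun p hi hj => hij (hCd hi hj)
  · exact fun i j hij => Set.disjoint_left.2 fun p hi hj => hij (hRd hi hj)
  · simp only [hC.ind_col, hR.ind_row]
    ext p q
    simp [hCR, Matrix.mul_apply, Matrix.sum_apply, Matrix.vecMulVec_apply]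
  · intro i
    rw [hC.ind_col]
    exact UFA.isMaxCol hMm hUn hSC hC hR hC1 hR1 hN hRd hCR i
  · intro i
    rw [hR.ind_row]
    obtain ⟨⟨w, q, h⟩, hmax⟩ :=
      UFA.isMaxCol hMm' hUn' hSC' hR' hC' hR1 hC1 hN' hCd hCR' i
    refine ⟨⟨w.reverse, q, h⟩, ?_⟩
    rintro _ ⟨v, p, rfl⟩
    exact hmax _ ⟨v.reverse, p, by simp [M']⟩
end

section
/- rank_un(M) = rank_ℝ(M), i.e., the minimum over all words w ∈ Σ* of the unambiguous rank of M(w) equals the minimum over all words w ∈ Σ* of the real rank of M(w). -/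
open Matrix

namespace UFA

variable {Q : Type*}

/-- In a finite type, a transitive and dense relation between two points passes through a
reflexive point. -/
theorem exists_refl_between [Finite Q] {r : Q → Q → Prop}
    (htr : ∀ a b c, r a b → r b c → r a c) (hd : ∀ a b, r a b → ∃ c, r a c ∧ r c b)
    {p q : Q} (h : r p q) : ∃ s, r p s ∧ r s s ∧ r s q := by
  by_contra! hno
  let t : {m // r p m ∧ r m q} → {m // r p m ∧ r m q} → Prop := fun a b => r a b
  have : IsTrans _ t := ⟨fun a b c => htr a b c⟩
  have : Std.Irrefl t := ⟨fun a ha => hno a a.2.1 ha a.2.2⟩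
  have wf := Finite.wellFounded_of_trans_of_irrefl t
  obtain ⟨m₀, hm₀⟩ := hd p q h
  obtain ⟨m, -, hm⟩ := wf.has_min Set.univ ⟨⟨m₀, hm₀⟩, trivial⟩
  obtain ⟨c, hpc, hcm⟩ := hd p m m.2.1
  exact hm ⟨c, hpc, htr _ _ _ hcm m.2.2⟩ trivial hcm

theorem rankUnMat_le_card {ι : Type*} [Fintype ι] {A : Matrix Q Q ℝ} (C : Matrix Q ι ℝ)
    (R : Matrix ι Q ℝ) (hC : ∀ i j, C i j = 0 ∨ C i j = 1) (hR : ∀ i j, R i j = 0 ∨ R i j = 1)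
    (h : A = C * R) : rankUnMat A ≤ Fintype.card ι := by
  let f := (Fintype.equivFin ι).symm
  refine Nat.sInf_le ⟨C.submatrix id f, R.submatrix f id, fun i j => hC _ _,
    fun i j => hR _ _, ?_⟩
  rw [submatrix_mul_equiv, h, submatrix_id_id]

theorem rank_le_rankUnMat [Fintype Q] [DecidableEq Q] {A : Matrix Q Q ℝ}
    (hA : ∀ i j, A i j = 0 ∨ A i j = 1) : A.rank ≤ rankUnMat A := by
  let f := (Fintype.equivFin Q).symm
  obtain ⟨C, R, -, -, h⟩ := Nat.sInf_mem (s := {r : ℕ | ∃ C : Matrix Q (Fin r) ℝ,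
    ∃ R : Matrix (Fin r) Q ℝ, (∀ i j, C i j = 0 ∨ C i j = 1) ∧
      (∀ i j, R i j = 0 ∨ R i j = 1) ∧ A = C * R}) ⟨_, A.submatrix id f,
    (1 : Matrix Q Q ℝ).submatrix f id, fun i j => hA _ _, fun i j => by
      simp only [submatrix_apply, one_apply]; split_ifs <;> simp, by
      rw [submatrix_mul_equiv, mul_one, submatrix_id_id]⟩
  calc A.rank = (C * R).rank := by rw [← h]
    _ ≤ C.rank := rank_mul_le_left C R
    _ ≤ rankUnMat A := C.rank_le_card_width.trans_eq (Fintype.card_fin _)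

theorem rank_eq_trace_of_isIdempotentElem {K : Type*} [Field K] [Fintype Q] [DecidableEq Q]
    {A : Matrix Q Q K} (h : IsIdempotentElem A) : (A.rank : K) = A.trace := by
  have hl : IsIdempotentElem (toLin' A) := by
    rw [IsIdempotentElem, Module.End.mul_eq_comp, ← toLin'_mul, h.eq]
  rw [← Matrix.trace_toLin'_eq, (LinearMap.isProj_range_iff_isIdempotentElem _ |>.2 hl).trace]
  rfl

theorem rankUnMat_le_rank_of_isIdempotentElem [Fintype Q] [DecidableEq Q] {A : Matrix Q Q ℝ}
    (hA : ∀ i j, A i j = 0 ∨ A i j = 1) (h : IsIdempotentElem A) : rankUnMat A ≤ A.rank := by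
  classical
  have hnn : ∀ i j, 0 ≤ A i j := fun i j => by rcases hA i j with h | h <;> simp [h]
  have hsum : ∀ i j, ∑ k, A i k * A k j = A i j := fun i j => by
    rw [← mul_apply, h.eq]
  have hle : ∀ i k j, A i k * A k j ≤ A i j := fun i k j => by
    rw [← hsum i j]
    exact Finset.single_le_sum (f := fun k => A i k * A k j)
      (fun k _ => mul_nonneg (hnn i k) (hnn k j)) (Finset.mem_univ k)
  have hcard : Fintype.card {s // A s s = 1} = A.rank := by
    have := rank_eq_trace_of_isIdempotentElem h
    rw [← Nat.cast_inj (R := ℝ), this, Fintype.card_subtype, Finset.card_filter, trace]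
    push_cast
    refine Finset.sum_congr rfl fun s _ => ?_
    rcases hA s s with h | h <;> simp [h]
  rw [← hcard]
  refine rankUnMat_le_card (A.submatrix id Subtype.val) (A.submatrix Subtype.val id)
    (fun i j => hA _ _) (fun i j => hA _ _) ?_
  ext p q
  simp only [mul_apply, submatrix_apply, id]
  have hnn' : ∀ k, 0 ≤ A p k * A k q := fun k => mul_nonneg (hnn _ _) (hnn _ _)
  have hup : ∑ s : {s // A s s = 1}, A p s * A s q ≤ A p q := by
    rw [← hsum p q, ← Finset.sum_subtype (Finset.univ.filter fun s => A s s = 1) (by simp)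
      (fun k => A p k * A k q)]
    exact Finset.sum_le_univ_sum_of_nonneg hnn'
  refine le_antisymm ?_ hup
  rcases hA p q with h0 | h1
  · rw [h0]
    exact Finset.sum_nonneg fun s _ => hnn' s
  · obtain ⟨s, hps, hss, hsq⟩ := exists_refl_between (r := fun a b => A a b = 1)
      (fun a b c hab hbc => by
        have := hle a b c
        rcases hA a c with h | h
        · norm_num [hab, hbc, h] at this
        · exact h)
      (fun a b hab => by
        by_contra! hno
        have : ∑ k, A a k * A k b = 0 := Finset.sum_eq_zero fun k _ => by
          rcases hA a k with h | h
          · simp [h]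
          · rw [(hA k b).resolve_right (hno k h), mul_zero]
        rw [hsum, hab] at this
        exact one_ne_zero this) h1
    calc A p q = A p s * A s q := by rw [h1, hps, hsq, one_mul]
      _ ≤ _ := Finset.single_le_sum (f := fun s : {s // A s s = 1} => A p s * A s q)
        (fun s _ => hnn' s) (Finset.mem_univ ⟨s, hss⟩)

theorem exists_pow_succ_isIdempotentElem {S : Type*} [Monoid S] (a : S)
    (hfin : (Set.range fun n : ℕ => a ^ n).Finite) : ∃ n, IsIdempotentElem (a ^ (n + 1)) := by
  obtain ⟨i, j, hij, heq⟩ : ∃ i j : ℕ, i < j ∧ a ^ i = a ^ j := by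
    by_contra! hne
    refine Set.infinite_range_of_injective (f := fun n : ℕ => a ^ n) (fun i j h => ?_) hfin
    rcases lt_trichotomy i j with hl | hl | hl
    · exact (hne i j hl h).elim
    · exact hl
    · exact (hne j i hl h.symm).elim
  obtain ⟨k, rfl⟩ := Nat.exists_eq_add_of_lt hij
  have hper : ∀ m n, i ≤ n → a ^ (n + m * (k + 1)) = a ^ n := by
    intro m n hn
    obtain ⟨d, rfl⟩ := Nat.exists_eq_add_of_le hn
    induction m with
    | zero => simp
    | succ m ih =>
      rw [← ih, show i + d + (m + 1) * (k + 1) = (i + k + 1) + (d + m * (k + 1)) by ring, pow_add,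
        ← heq, ← pow_add, add_assoc]
  refine ⟨i * (k + 1) + k, ?_⟩
  rw [IsIdempotentElem, ← pow_add,
    show i * (k + 1) + k + 1 + (i * (k + 1) + k + 1) =
      i * (k + 1) + k + 1 + (i + 1) * (k + 1) by ring]
  exact hper _ _ (by nlinarith)

end UFA

theorem rankUn_eq_rankReal {Q σ : Type*} [Fintype Q] [DecidableEq Q] [Nonempty Q]
    [Fintype σ] [Nonempty σ]
    (M : List σ → Matrix Q Q ℝ)
    (hM0 : M [] = 1) (hMm : ∀ u v, M (u ++ v) = M u * M v)
    (hUn : ∀ w i j, M w i j = 0 ∨ M w i j = 1)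
    (hComp : ∀ w, M w ≠ 0)
    (hSC : ∀ p q : Q, ∃ w, M w p q = 1)
 :
    UFA.rankUn M = UFA.rankReal M := by
  have hpow : ∀ w n, M (List.replicate n w).flatten = M w ^ n := by
    intro w n
    induction n with
    | zero => simpa using hM0
    | succ n ih => rw [List.replicate_succ, List.flatten_cons, hMm, ih, pow_succ']
  apply le_antisymm
  · obtain ⟨w, hw⟩ : UFA.rankReal M ∈ Set.range fun w => (M w).rank :=
      Nat.sInf_mem (Set.range_nonempty _)
    have hfin : {A : Matrix Q Q ℝ | ∀ i j, A i j ∈ ({0, 1} : Set ℝ)}.Finite := by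
      refine (Set.Finite.pi' fun _ => Set.Finite.pi' fun _ => Set.toFinite _)
    obtain ⟨n, hn⟩ := UFA.exists_pow_succ_isIdempotentElem (M w) (hfin.subset (by
      rintro _ ⟨n, rfl⟩ i j
      simpa [← hpow] using hUn _ i j))
    rw [← hpow] at hn
    calc UFA.rankUn M ≤ UFA.rankUnMat (M (List.replicate (n + 1) w).flatten) :=
        Nat.sInf_le ⟨_, rfl⟩
      _ ≤ (M (List.replicate (n + 1) w).flatten).rank :=
        UFA.rankUnMat_le_rank_of_isIdempotentElem (hUn _) hn
      _ = (M w * M w ^ n).rank := by rw [hpow, pow_succ']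
      _ ≤ (M w).rank := rank_mul_le_left _ _
      _ = UFA.rankReal M := hw
  · obtain ⟨w, hw⟩ : UFA.rankUn M ∈ Set.range fun w => UFA.rankUnMat (M w) :=
      Nat.sInf_mem (Set.range_nonempty _)
    calc UFA.rankReal M ≤ (M w).rank := Nat.sInf_le ⟨w, rfl⟩
      _ ≤ UFA.rankUnMat (M w) := UFA.rank_le_rankUnMat (hUn w)
      _ = UFA.rankUn M := hw
end

section
/- A column is maximal if and only if its weight equals mcw, and a row is maximal if and only if its weight equals mrw. -/
open Matrix

namespace UFA

variable {Q σ : Type*}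

theorem IsCol.mulVec [Fintype Q] {M : List σ → Matrix Q Q ℝ} (hMm : ∀ u v, M (u ++ v) = M u * M v)
    {y : Q → ℝ} (hy : IsCol M y) (u : List σ) : IsCol M (M u *ᵥ y) := by
  obtain ⟨w, q, rfl⟩ := hy
  refine ⟨u ++ w, q, ?_⟩
  rw [hMm]
  rfl

/-- A column of maximum weight stays of maximum weight when a word acts on it. -/
theorem weight_mulVec_eq_of_maximum [Fintype Q] [DecidableEq Q] [Fintype σ] [Nonempty σ]
    {M : List σ → Matrix Q Q ℝ} (hM0 : M [] = 1) (hMm : ∀ u v, M (u ++ v) = M u * M v)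
    {α : Q → ℝ} (hαA : α ᵥ* ((Fintype.card σ : ℝ)⁻¹ • ∑ a : σ, M [a]) = α)
    {m : ℝ} (hm : ∀ y, IsCol M y → α ⬝ᵥ y ≤ m)
    {y : Q → ℝ} (hy : IsCol M y) (hym : α ⬝ᵥ y = m) (u : List σ) :
    α ⬝ᵥ (M u *ᵥ y) = m := by
  induction u with
  | nil => simpa [hM0] using hym
  | cons a u ih =>
    have hz : IsCol M (M u *ᵥ y) := hy.mulVec hMm u
    have hcard : (Fintype.card σ : ℝ) ≠ 0 := by exact_mod_cast Fintype.card_ne_zero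
    have havg : ∑ b : σ, α ⬝ᵥ (M [b] *ᵥ (M u *ᵥ y)) = ∑ _b : σ, m := by
      have h := ih
      rw [← hαA, ← dotProduct_mulVec, smul_mulVec, dotProduct_smul, sum_mulVec,
        dotProduct_sum, smul_eq_mul, inv_mul_eq_iff_eq_mul₀ hcard] at h
      simpa using h
    have hall := (Finset.sum_eq_sum_iff_of_le
      fun b _ => hm _ (hz.mulVec hMm [b])).1 havg a (Finset.mem_univ a)
    rwa [mulVec_mulVec, ← hMm] at hall

theorem isMaxCol_iff_weight_eq [Fintype Q] [DecidableEq Q] [Nonempty Q] [Fintype σ] [Nonempty σ]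
    {M : List σ → Matrix Q Q ℝ} (hM0 : M [] = 1) (hMm : ∀ u v, M (u ++ v) = M u * M v)
    (hUn : ∀ w i j, M w i j = 0 ∨ M w i j = 1) (hSC : ∀ p q : Q, ∃ w, M w p q = 1)
    {α : Q → ℝ} (hα : ∀ q, 0 < α q)
    (hαA : α ᵥ* ((Fintype.card σ : ℝ)⁻¹ • ∑ a : σ, M [a]) = α)
    {m : ℝ} (hm₁ : ∃ y, IsCol M y ∧ α ⬝ᵥ y = m) (hm₂ : ∀ y, IsCol M y → α ⬝ᵥ y ≤ m)
    {y : Q → ℝ} (hy : IsCol M y) : IsMaxCol M y ↔ α ⬝ᵥ y = m := by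
  have hnn : ∀ w i j, 0 ≤ M w i j := fun w i j => by
    rcases hUn w i j with h | h <;> simp [h]
  constructor
  · rintro ⟨⟨w, q, rfl⟩, hmax⟩
    obtain ⟨c, hc, hcm⟩ := hm₁
    have hc' := hc
    obtain ⟨v, r, hcv⟩ := hc'
    obtain ⟨p, hp⟩ : ∃ p, c p = 1 := by
      by_contra! h
      have hc0 : c = 0 := funext fun p => by
        have := h p
        rw [hcv] at this ⊢
        exact (hUn v p r).resolve_right this
      obtain ⟨q₀⟩ := ‹Nonempty Q›
      have h1 := hm₂ _ ⟨[], q₀, rfl⟩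
      have h2 : α ⬝ᵥ (fun p => M [] p q₀) = α q₀ := by
        simp [hM0, dotProduct, Matrix.one_apply]
      rw [h2, ← hcm, hc0, dotProduct_zero] at h1
      exact absurd (hα q₀) (not_lt.2 h1)
    obtain ⟨x, hx⟩ := hSC q p
    have hc_nonneg : ∀ i, 0 ≤ c i := fun i => by rw [hcv]; exact hnn _ _ _
    have hxc : 1 ≤ (M x *ᵥ c) q := by
      have := Finset.single_le_sum (f := fun i => M x q i * c i)
        (fun i _ => mul_nonneg (hnn x q i) (hc_nonneg i)) (Finset.mem_univ p)
      simpa [hx, hp, mulVec, dotProduct] using this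
    have hxc_nonneg : ∀ i, 0 ≤ (M x *ᵥ c) i := fun i =>
      Finset.sum_nonneg fun j _ => mul_nonneg (hnn x i j) (hc_nonneg j)
    have hle : (fun p => M w p q) ≤ M w *ᵥ (M x *ᵥ c) := fun i => by
      have := Finset.single_le_sum (f := fun j => M w i j * (M x *ᵥ c) j)
        (fun j _ => mul_nonneg (hnn w i j) (hxc_nonneg j)) (Finset.mem_univ q)
      exact (le_mul_of_one_le_right (hnn w i q) hxc).trans this
    rw [← hmax _ ((hc.mulVec hMm x).mulVec hMm w) hle, mulVec_mulVec, ← hMm]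
    exact weight_mulVec_eq_of_maximum hM0 hMm hαA hm₂ hc hcm (w ++ x)
  · refine fun hym => ⟨hy, fun y' hy' hle => ?_⟩
    have hw : ∑ i, α i * y i = ∑ i, α i * y' i :=
      le_antisymm
        (Finset.sum_le_sum fun i _ => mul_le_mul_of_nonneg_left (hle i) (hα i).le)
        ((hm₂ y' hy').trans hym.ge)
    have hall := (Finset.sum_eq_sum_iff_of_le
      fun i _ => mul_le_mul_of_nonneg_left (hle i) (hα i).le).1 hw
    exact funext fun i => (mul_left_cancel₀ (hα i).ne' (hall i (Finset.mem_univ i))).symm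

/-- The reversed morphism `w ↦ M(wᴿ)ᵀ`, whose columns are the rows of `M`. -/
def reversal (M : List σ → Matrix Q Q ℝ) (w : List σ) : Matrix Q Q ℝ := (M w.reverse)ᵀ

theorem isCol_reversal {M : List σ → Matrix Q Q ℝ} {x : Q → ℝ} :
    IsCol (reversal M) x ↔ IsRow M x := by
  constructor
  · rintro ⟨w, q, rfl⟩
    exact ⟨w.reverse, q, rfl⟩
  · rintro ⟨w, q, rfl⟩
    exact ⟨w.reverse, q, by simp [reversal]⟩

theorem isMaxCol_reversal {M : List σ → Matrix Q Q ℝ} {x : Q → ℝ} :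
    IsMaxCol (reversal M) x ↔ IsMaxRow M x := by
  simp only [IsMaxCol, IsMaxRow, isCol_reversal]

end UFA

theorem maximal_iff_maximum_weight {Q σ : Type*} [Fintype Q] [DecidableEq Q] [Nonempty Q]
    [Fintype σ] [Nonempty σ]
    (M : List σ → Matrix Q Q ℝ)
    (hM0 : M [] = 1) (hMm : ∀ u v, M (u ++ v) = M u * M v)
    (hUn : ∀ w i j, M w i j = 0 ∨ M w i j = 1)
    (hComp : ∀ w, M w ≠ 0)
    (hSC : ∀ p q : Q, ∃ w, M w p q = 1)
    (α β : Q → ℝ) (hα : ∀ q, 0 < α q) (hβ : ∀ q, 0 < β q)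
    (hαA : α ᵥ* ((Fintype.card σ : ℝ)⁻¹ • ∑ a : σ, M [a]) = α)
    (hβA : ((Fintype.card σ : ℝ)⁻¹ • ∑ a : σ, M [a]) *ᵥ β = β)
    (hαβ : α ⬝ᵥ β = 1)
    (mcw : ℝ) (hmcw₁ : ∃ y, UFA.IsCol M y ∧ α ⬝ᵥ y = mcw)
    (hmcw₂ : ∀ y, UFA.IsCol M y → α ⬝ᵥ y ≤ mcw)
    (mrw : ℝ) (hmrw₁ : ∃ x, UFA.IsRow M x ∧ x ⬝ᵥ β = mrw)
    (hmrw₂ : ∀ x, UFA.IsRow M x → x ⬝ᵥ β ≤ mrw)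
 :
    (∀ y, UFA.IsCol M y → (UFA.IsMaxCol M y ↔ α ⬝ᵥ y = mcw)) ∧
    (∀ x, UFA.IsRow M x → (UFA.IsMaxRow M x ↔ x ⬝ᵥ β = mrw)) := by
  refine ⟨fun y hy => UFA.isMaxCol_iff_weight_eq hM0 hMm hUn hSC hα hαA hmcw₁ hmcw₂ hy,
    fun x hx => ?_⟩
  rw [← UFA.isMaxCol_reversal, dotProduct_comm]
  refine UFA.isMaxCol_iff_weight_eq (M := UFA.reversal M) ?_ ?_ (fun w i j => hUn w.reverse j i)
    ?_ hβ ?_ ?_ ?_ (UFA.isCol_reversal.2 hx)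
  · simp [UFA.reversal, hM0]
  · intro u v
    simp [UFA.reversal, hMm, transpose_mul]
  · intro p q
    obtain ⟨w, hw⟩ := hSC q p
    exact ⟨w.reverse, by simpa [UFA.reversal] using hw⟩
  · rw [← mulVec_transpose]
    simpa [UFA.reversal, transpose_sum] using hβA
  · obtain ⟨z, hz, hzm⟩ := hmrw₁
    exact ⟨z, UFA.isCol_reversal.2 hz, by rwa [dotProduct_comm]⟩
  · intro z hz
    rw [dotProduct_comm]
    exact hmrw₂ z (UFA.isCol_reversal.1 hz)
end

section
/- Let w ∈ Σ* be such that every nonzero column of M(w) is a maximal column and every nonzero row of M(w) is a maximal row. Then the word ww is of minimum rank, i.e., rank_un(M(ww)) = rank_un(M). -/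
open Matrix

namespace UFA

theorem mul_apply_ne_zero_iff {l m n : Type*} [Fintype m] {A : Matrix l m ℝ} {B : Matrix m n ℝ}
    (hA : ∀ i j, 0 ≤ A i j) (hB : ∀ i j, 0 ≤ B i j) (i : l) (j : n) :
    (A * B) i j ≠ 0 ↔ ∃ k, A i k ≠ 0 ∧ B k j ≠ 0 := by
  rw [Matrix.mul_apply, ne_eq,
    Finset.sum_eq_zero_iff_of_nonneg fun k _ => mul_nonneg (hA i k) (hB k j)]
  simp

theorem nonneg_of_zero_or_one {a : ℝ} (h : a = 0 ∨ a = 1) : 0 ≤ a := by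
  rcases h with h | h <;> simp [h]

variable {Q σ : Type*} {M : List σ → Matrix Q Q ℝ}

theorem append_ne_zero_iff [Fintype Q] (hMm : ∀ u v, M (u ++ v) = M u * M v)
    (hUn : ∀ w i j, M w i j = 0 ∨ M w i j = 1) (u v : List σ) (i j : Q) :
    M (u ++ v) i j ≠ 0 ↔ ∃ k, M u i k ≠ 0 ∧ M v k j ≠ 0 := by
  rw [hMm]
  exact mul_apply_ne_zero_iff (fun i j => nonneg_of_zero_or_one (hUn u i j))
    (fun i j => nonneg_of_zero_or_one (hUn v i j)) i j

theorem le_of_support {α : Type*} {x y : α → ℝ} (hx : ∀ i, x i = 0 ∨ x i = 1)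
    (hy : ∀ i, y i = 0 ∨ y i = 1) (h : ∀ i, x i ≠ 0 → y i ≠ 0) : x ≤ y := by
  intro i
  rcases hx i with h₀ | h₁
  · rw [h₀]
    exact nonneg_of_zero_or_one (hy i)
  · rw [h₁, (hy i).resolve_left (h i (by simp [h₁]))]

/-- In a complete strongly connected unambiguous monoid, no word maps a maximal row to zero. -/
theorem IsMaxRow.append_ne_zero [Fintype Q] (hMm : ∀ u v, M (u ++ v) = M u * M v)
    (hUn : ∀ w i j, M w i j = 0 ∨ M w i j = 1) (hComp : ∀ w, M w ≠ 0)
    (hSC : ∀ p q : Q, ∃ w, M w p q = 1) {w : List σ} {p : Q}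
    (hmax : IsMaxRow M (fun q => M w p q)) (u : List σ) :
    ∃ q, M (w ++ u) p q ≠ 0 := by
  classical
  by_contra! hkill
  have key : ∀ n v, (Finset.univ.filter fun i => M v i ≠ 0).card = n → False := by
    intro n
    induction n using Nat.strong_induction_on with
    | _ n ih =>
      intro v hn
      obtain ⟨i, hi⟩ := Function.ne_iff.mp (hComp v)
      obtain ⟨q, hq⟩ := Function.ne_iff.mp hi
      obtain ⟨t, ht⟩ := hSC q p
      have hp : M (v ++ t) i p ≠ 0 :=
        (append_ne_zero_iff hMm hUn _ _ _ _).mpr ⟨q, hq, by simp [ht]⟩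
      have hrow : (fun j => M ((v ++ t) ++ w) i j) = fun j => M w p j :=
        hmax.2 _ ⟨_, _, rfl⟩ (le_of_support (hUn w p) (hUn _ i) fun j hj =>
          (append_ne_zero_iff hMm hUn _ _ _ _).mpr ⟨p, hp, hj⟩)
      have hzero : M (((v ++ t) ++ w) ++ u) i = 0 := by
        funext j
        by_contra h
        obtain ⟨k, hk, hkj⟩ := (append_ne_zero_iff hMm hUn _ _ _ _).mp h
        rw [congrFun hrow k] at hk
        exact (append_ne_zero_iff hMm hUn _ _ _ _).mpr ⟨k, hk, hkj⟩ (hkill j)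
      refine ih _ ?_ (((v ++ t) ++ w) ++ u) rfl
      rw [← hn]
      refine Finset.card_lt_card (Finset.ssubset_iff_of_subset ?_ |>.mpr ⟨i, ?_, ?_⟩)
      · intro j hj
        simp only [Finset.mem_filter, Finset.mem_univ, true_and] at hj ⊢
        obtain ⟨k, hk⟩ := Function.ne_iff.mp hj
        rw [List.append_assoc, List.append_assoc] at hk
        obtain ⟨l, hl, -⟩ := (append_ne_zero_iff hMm hUn _ _ _ _).mp hk
        exact Function.ne_iff.mpr ⟨l, hl⟩
      · exact Finset.mem_filter.mpr ⟨Finset.mem_univ i, hi⟩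
      · simpa using hzero
  exact key _ w rfl

/-- If all nonzero columns of `M w` are maximal, then every column of `M` contains at most one
state whose column in `M w` is nonzero. -/
theorem eq_of_mem_column [Fintype Q] (hMm : ∀ u v, M (u ++ v) = M u * M v)
    (hUn : ∀ w i j, M w i j = 0 ∨ M w i j = 1) {w : List σ}
    (hcol : ∀ q : Q, (fun p => M w p q) ≠ 0 → IsMaxCol M (fun p => M w p q))
    {v : List σ} {a b q : Q} (ha : (fun p => M w p a) ≠ 0) (hb : (fun p => M w p b) ≠ 0)
    (hav : M v a q ≠ 0) (hbv : M v b q ≠ 0) : a = b := by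
  classical
  by_contra hab
  obtain ⟨p, hp⟩ := Function.ne_iff.mp hb
  have heq : ∀ c, (fun p => M w p c) ≠ 0 → M v c q ≠ 0 →
      (fun p => M (w ++ v) p q) = fun p => M w p c := fun c hc hcv =>
    (hcol c hc).2 _ ⟨_, _, rfl⟩ (le_of_support (fun i => hUn w i c) (fun i => hUn _ i q)
      fun j hj => (append_ne_zero_iff hMm hUn _ _ _ _).mpr ⟨c, hj, hcv⟩)
  have hpb : M w p b = 1 := (hUn w p b).resolve_left hp
  have hpa : M w p a = 1 := by
    rw [← congrFun (heq a ha hav) p, congrFun (heq b hb hbv) p, hpb]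
  have h2 : (2 : ℝ) ≤ M (w ++ v) p q := by
    rw [hMm, Matrix.mul_apply]
    calc (2 : ℝ) = ∑ k ∈ {a, b}, M w p k * M v k q := by
          rw [Finset.sum_pair hab, hpa, hpb, (hUn v a q).resolve_left hav,
            (hUn v b q).resolve_left hbv]
          norm_num
      _ ≤ ∑ k, M w p k * M v k q :=
          Finset.sum_le_sum_of_subset_of_nonneg (Finset.subset_univ _) fun k _ _ =>
            mul_nonneg (nonneg_of_zero_or_one (hUn _ _ _)) (nonneg_of_zero_or_one (hUn _ _ _))
  rcases hUn (w ++ v) p q with h | h <;> rw [h] at h2 <;> norm_num at h2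

/-- The unambiguous rank of a product of zero-one matrices is at most the number of inner indices
that contribute to the product. -/
theorem rankUnMat_mul_le [Fintype Q] {A B : Matrix Q Q ℝ} (hA : ∀ i j, A i j = 0 ∨ A i j = 1)
    (hB : ∀ i j, B i j = 0 ∨ B i j = 1) (s : Finset Q)
    (hs : ∀ k, k ∉ s → (fun i => A i k) = 0 ∨ (fun j => B k j) = 0) :
    rankUnMat (A * B) ≤ s.card := by
  refine Nat.sInf_le ⟨Matrix.of fun i k => A i (s.equivFin.symm k),
    Matrix.of fun k j => B (s.equivFin.symm k) j,
    fun i k => hA _ _, fun k j => hB _ _, ?_⟩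
  ext i j
  simp only [Matrix.mul_apply, Matrix.of_apply]
  rw [s.equivFin.symm.sum_comp (fun k : s => A i k * B k j),
    Finset.sum_coe_sort s (fun k => A i k * B k j)]
  refine (Finset.sum_subset (Finset.subset_univ s) fun k _ hk => ?_).symm
  rcases hs k hk with h | h
  · rw [show A i k = 0 from congrFun h i, zero_mul]
  · rw [show B k j = 0 from congrFun h j, mul_zero]

theorem exists_factorization_rankUnMat [Fintype Q] [DecidableEq Q] {A : Matrix Q Q ℝ}
    (hA : ∀ i j, A i j = 0 ∨ A i j = 1) :
    ∃ C : Matrix Q (Fin (rankUnMat A)) ℝ, ∃ R : Matrix (Fin (rankUnMat A)) Q ℝ,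
      (∀ i j, C i j = 0 ∨ C i j = 1) ∧ (∀ i j, R i j = 0 ∨ R i j = 1) ∧ A = C * R := by
  let e := Fintype.equivFin Q
  refine Nat.sInf_mem (s := {r : ℕ | ∃ C : Matrix Q (Fin r) ℝ, ∃ R : Matrix (Fin r) Q ℝ,
    (∀ i j, C i j = 0 ∨ C i j = 1) ∧ (∀ i j, R i j = 0 ∨ R i j = 1) ∧ A = C * R})
    ⟨Fintype.card Q, A.submatrix id e.symm, (1 : Matrix Q Q ℝ).submatrix e.symm id,
      fun i j => hA _ _, fun i j => ?_, ?_⟩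
  · rw [Matrix.submatrix_apply, Matrix.one_apply]
    split_ifs <;> simp
  · rw [Matrix.submatrix_mul_equiv, mul_one, Matrix.submatrix_id_id]

end UFA

theorem all_max_columns_rows_gives_min_rank {Q σ : Type*} [Fintype Q] [DecidableEq Q] [Nonempty Q]
    [Fintype σ] [Nonempty σ]
    (M : List σ → Matrix Q Q ℝ)
    (hM0 : M [] = 1) (hMm : ∀ u v, M (u ++ v) = M u * M v)
    (hUn : ∀ w i j, M w i j = 0 ∨ M w i j = 1)
    (hComp : ∀ w, M w ≠ 0)
    (hSC : ∀ p q : Q, ∃ w, M w p q = 1)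
    (w : List σ)
    (hcol : ∀ q : Q, (fun p => M w p q) ≠ 0 → UFA.IsMaxCol M (fun p => M w p q))
    (hrow : ∀ q : Q, (fun p => M w q p) ≠ 0 → UFA.IsMaxRow M (fun p => M w q p)) :
    UFA.rankUnMat (M (w ++ w)) = UFA.rankUn M := by
  classical
  refine le_antisymm ?_ (Nat.sInf_le ⟨_, rfl⟩)
  obtain ⟨u, hu⟩ : UFA.rankUn M ∈ Set.range fun w => UFA.rankUnMat (M w) :=
    Nat.sInf_mem (Set.range_nonempty _)
  rw [← hu]
  obtain ⟨C, R, hC, hR, hCR⟩ := UFA.exists_factorization_rankUnMat (hUn u)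
  let s : Finset Q :=
    Finset.univ.filter fun q => (fun p => M w p q) ≠ 0 ∧ (fun p => M w q p) ≠ 0
  have hmem : ∀ q, q ∈ s ↔ (fun p => M w p q) ≠ 0 ∧ (fun p => M w q p) ≠ 0 := by simp [s]
  have hR0 : ∀ i j, 0 ≤ R i j := fun i j => UFA.nonneg_of_zero_or_one (hR i j)
  have hwC : ∀ p i, 0 ≤ (M w * C) p i := fun p i => by
    rw [Matrix.mul_apply]
    exact Finset.sum_nonneg fun k _ => mul_nonneg (UFA.nonneg_of_zero_or_one (hUn _ _ _))
      (UFA.nonneg_of_zero_or_one (hC _ _))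
  have hprod : ∀ p q, M (w ++ u) p q ≠ 0 ↔ ∃ i, (M w * C) p i ≠ 0 ∧ R i q ≠ 0 := fun p q => by
    rw [hMm, (congrArg (M w * ·) hCR).trans (Matrix.mul_assoc _ _ _).symm]
    exact UFA.mul_apply_ne_zero_iff hwC hR0 p q
  have hex : ∀ p : s, ∃ i, (M w * C) p i ≠ 0 ∧ ∃ q, R i q ≠ 0 := fun p => by
    have hp := ((hmem p).mp p.2).2
    obtain ⟨q, hq⟩ := (hrow p hp).append_ne_zero hMm hUn hComp hSC u
    obtain ⟨i, hi, hiq⟩ := (hprod _ _).mp hq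
    exact ⟨i, hi, q, hiq⟩
  choose f hf g hg using hex
  have hinj : Function.Injective f := fun a b hab => Subtype.ext <|
    UFA.eq_of_mem_column hMm hUn hcol ((hmem a).mp a.2).1 ((hmem b).mp b.2).1
      ((hprod a (g a)).mpr ⟨f a, hf a, hg a⟩) ((hprod b (g a)).mpr ⟨f a, hab ▸ hf b, hg a⟩)
  have hcard : s.card ≤ UFA.rankUnMat (M u) := by
    simpa using Fintype.card_le_of_injective f hinj
  rw [hMm]
  refine (UFA.rankUnMat_mul_le (hUn w) (hUn w) s fun k hk => ?_).trans hcard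
  rw [hmem] at hk
  tauto
end

section
/- For all words w ∈ Σ* one has α^T M(w) β = 1, and moreover 1 = r · mcw · mrw, where r := rank_un(M). -/
open Matrix

namespace UFA

variable {Q σ : Type*}

/-- If the weight of `M u *ᵥ y` is maximal for `u = []`, it is maximal for every `u`. -/
theorem dotProduct_mulVec_eq_of_forall_le [Fintype Q] [Fintype σ] [DecidableEq Q] [Nonempty σ]
    (M : List σ → Matrix Q Q ℝ) (hM0 : M [] = 1) (hMm : ∀ u v, M (u ++ v) = M u * M v)
    (α : Q → ℝ) (hαA : α ᵥ* ((Fintype.card σ : ℝ)⁻¹ • ∑ a : σ, M [a]) = α)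
    (y : Q → ℝ) (m : ℝ) (hle : ∀ u, α ⬝ᵥ (M u *ᵥ y) ≤ m) (hy : α ⬝ᵥ y = m) (u : List σ) :
    α ⬝ᵥ (M u *ᵥ y) = m := by
  induction u with
  | nil => simpa [hM0] using hy
  | cons a u ih =>
    have hsplit (b : σ) : M (b :: u) *ᵥ y = M [b] *ᵥ (M u *ᵥ y) := by
      rw [mulVec_mulVec, ← hMm]; rfl
    have hcard : (Fintype.card σ : ℝ) ≠ 0 := by simp
    have hsum : ∑ b : σ, α ⬝ᵥ (M (b :: u) *ᵥ y) = ∑ _b : σ, m := by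
      have h := congrArg (· ⬝ᵥ (M u *ᵥ y)) hαA
      simp only [vecMul_smul, smul_dotProduct, ← dotProduct_mulVec, sum_mulVec, dotProduct_sum,
        ih, smul_eq_mul] at h
      simp only [hsplit, Finset.sum_const, Finset.card_univ, nsmul_eq_mul]
      rw [← h, mul_inv_cancel_left₀ hcard]
    exact (Finset.sum_eq_sum_iff_of_le fun b _ => hle (b :: u)).1 hsum a (Finset.mem_univ a)

theorem col_append [Fintype Q] (M : List σ → Matrix Q Q ℝ) (hMm : ∀ u v, M (u ++ v) = M u * M v)
    (u v : List σ) (q : Q) :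
    (fun p => M (u ++ v) p q) = M u *ᵥ fun p => M v p q := by
  ext p
  rw [hMm]; rfl

/-- There is a word all of whose nonzero columns have maximum weight. -/
theorem exists_forall_col_eq_zero_or_dotProduct_eq [Fintype Q] [Fintype σ]
    [DecidableEq Q] [Nonempty σ]
    (M : List σ → Matrix Q Q ℝ) (hM0 : M [] = 1) (hMm : ∀ u v, M (u ++ v) = M u * M v)
    (hUn : ∀ w i j, M w i j = 0 ∨ M w i j = 1)
    (hSC : ∀ p q : Q, ∃ w, M w p q = 1)
    (α : Q → ℝ) (hα : ∀ q, 0 < α q)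
    (hαA : α ᵥ* ((Fintype.card σ : ℝ)⁻¹ • ∑ a : σ, M [a]) = α)
    (m : ℝ) (hm₁ : ∃ y, IsCol M y ∧ α ⬝ᵥ y = m) (hm₂ : ∀ y, IsCol M y → α ⬝ᵥ y ≤ m) :
    ∃ w, ∀ q, (fun p => M w p q) = 0 ∨ α ⬝ᵥ (fun p => M w p q) = m := by
  obtain ⟨_, ⟨w₀, q₀, rfl⟩, hw₀⟩ := hm₁
  have hnonneg (w : List σ) (i j : Q) : 0 ≤ M w i j := by
    rcases hUn w i j with h | h <;> simp [h]
  have hleft (u v : List σ) (q : Q) (h : α ⬝ᵥ (fun p => M v p q) = m) :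
      α ⬝ᵥ (fun p => M (u ++ v) p q) = m := by
    rw [col_append M hMm]
    refine dotProduct_mulVec_eq_of_forall_le M hM0 hMm α hαA _ m (fun u => ?_) h u
    rw [← col_append M hMm]
    exact hm₂ _ ⟨_, _, rfl⟩
  suffices H : ∀ S : Finset Q, ∃ w, ∀ q ∈ S,
      (fun p => M w p q) = 0 ∨ α ⬝ᵥ (fun p => M w p q) = m by
    obtain ⟨w, hw⟩ := H Finset.univ
    exact ⟨w, fun q => hw q (Finset.mem_univ q)⟩
  intro S
  induction S using Finset.induction_on with
  | empty => exact ⟨[], by simp⟩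
  | insert q S _ ih =>
    obtain ⟨w, hw⟩ := ih
    by_cases hq : (fun p => M w p q) = 0
    · exact ⟨w, (Finset.forall_mem_insert _ _ _).2 ⟨.inl hq, hw⟩⟩
    obtain ⟨p, hp⟩ := Function.ne_iff.1 hq
    have hp1 : M w p q = 1 := (hUn w p q).resolve_left hp
    obtain ⟨s, hs⟩ := hSC q₀ p
    refine ⟨w₀ ++ (s ++ w), (Finset.forall_mem_insert _ _ _).2 ⟨.inr ?_, fun q' hq' => ?_⟩⟩
    · refine le_antisymm (hm₂ _ ⟨_, _, rfl⟩) ?_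
      rw [← hw₀]
      refine dotProduct_le_dotProduct_of_nonneg_left (fun i => ?_) fun i => (hα i).le
      have hone : 1 ≤ M (s ++ w) q₀ q := by
        rw [hMm, mul_apply]
        calc (1 : ℝ) = M s q₀ p * M w p q := by rw [hs, hp1, one_mul]
          _ ≤ _ := Finset.single_le_sum
            (f := fun k => M s q₀ k * M w k q)
            (fun k _ => mul_nonneg (hnonneg _ _ _) (hnonneg _ _ _)) (Finset.mem_univ p)
      rw [hMm w₀, mul_apply]
      calc M w₀ i q₀ ≤ M w₀ i q₀ * M (s ++ w) q₀ q :=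
            le_mul_of_one_le_right (hnonneg _ _ _) hone
        _ ≤ _ := Finset.single_le_sum
          (f := fun k => M w₀ i k * M (s ++ w) k q)
          (fun k _ => mul_nonneg (hnonneg _ _ _) (hnonneg _ _ _)) (Finset.mem_univ q₀)
    · rw [← List.append_assoc]
      rcases hw q' hq' with h | h
      · left
        rw [col_append M hMm, h, mulVec_zero]
      · exact .inr (hleft _ _ _ h)

/-- The morphism read backwards and transposed: its columns are the rows of `M`. -/
def reverseTranspose (M : List σ → Matrix Q Q ℝ) (w : List σ) : Matrix Q Q ℝ := (M w.reverse)ᵀ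

theorem reverseTranspose_append [Fintype Q] (M : List σ → Matrix Q Q ℝ)
    (hMm : ∀ u v, M (u ++ v) = M u * M v) (u v : List σ) :
    reverseTranspose M (u ++ v) = reverseTranspose M u * reverseTranspose M v := by
  simp [reverseTranspose, hMm]

theorem vecMul_average_reverseTranspose [Fintype Q] [Fintype σ]
    (M : List σ → Matrix Q Q ℝ) (β : Q → ℝ)
    (hβA : ((Fintype.card σ : ℝ)⁻¹ • ∑ a : σ, M [a]) *ᵥ β = β) :
    β ᵥ* ((Fintype.card σ : ℝ)⁻¹ • ∑ a : σ, reverseTranspose M [a]) = β := by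
  simpa [reverseTranspose, ← transpose_sum, ← transpose_smul, vecMul_transpose] using hβA

theorem isCol_reverseTranspose_iff (M : List σ → Matrix Q Q ℝ) (x : Q → ℝ) :
    IsCol (reverseTranspose M) x ↔ IsRow M x := by
  constructor
  · rintro ⟨w, q, rfl⟩
    exact ⟨w.reverse, q, rfl⟩
  · rintro ⟨w, q, rfl⟩
    exact ⟨w.reverse, q, by simp [reverseTranspose]⟩

theorem dotProduct_mulVec_eq_one [Fintype Q] [Fintype σ] [DecidableEq Q] [Nonempty σ]
    (M : List σ → Matrix Q Q ℝ) (hM0 : M [] = 1) (hMm : ∀ u v, M (u ++ v) = M u * M v)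
    (hUn : ∀ w i j, M w i j = 0 ∨ M w i j = 1) (α β : Q → ℝ)
    (hαA : α ᵥ* ((Fintype.card σ : ℝ)⁻¹ • ∑ a : σ, M [a]) = α)
    (hβA : ((Fintype.card σ : ℝ)⁻¹ • ∑ a : σ, M [a]) *ᵥ β = β)
    (hαβ : α ⬝ᵥ β = 1) (w : List σ) : α ⬝ᵥ (M w *ᵥ β) = 1 := by
  have hfin : (Set.range M).Finite :=
    (Set.Finite.pi' fun _ => Set.Finite.pi' fun _ => Set.toFinite ({0, 1} : Set ℝ)).subset
      (by rintro _ ⟨w, rfl⟩ i j; exact hUn w i j)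
  have hne : (Set.range M).Nonempty := Set.range_nonempty M
  obtain ⟨_, ⟨w₀, rfl⟩, hmax⟩ := hfin.exists_maximalFor (fun A => α ⬝ᵥ (A *ᵥ β)) _ hne
  obtain ⟨_, ⟨w₁, rfl⟩, hmin⟩ := hfin.exists_minimalFor (fun A => α ⬝ᵥ (A *ᵥ β)) _ hne
  have hmax' (u) : α ⬝ᵥ (M u *ᵥ β) ≤ α ⬝ᵥ (M w₀ *ᵥ β) :=
    (le_total _ _).elim id fun h => hmax ⟨u, rfl⟩ h
  have hmin' (u) : α ⬝ᵥ (M w₁ *ᵥ β) ≤ α ⬝ᵥ (M u *ᵥ β) :=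
    (le_total _ _).elim id fun h => hmin ⟨u, rfl⟩ h
  have h₀ : α ⬝ᵥ (M (w₁ ++ w₀) *ᵥ β) = α ⬝ᵥ (M w₀ *ᵥ β) := by
    rw [hMm, ← mulVec_mulVec]
    refine dotProduct_mulVec_eq_of_forall_le M hM0 hMm α hαA _ _ (fun u => ?_) rfl w₁
    rw [mulVec_mulVec, ← hMm]
    exact hmax' _
  have hdual (v : List σ) :
      β ⬝ᵥ (reverseTranspose M v *ᵥ (-(α ᵥ* M w₁))) = -(α ⬝ᵥ (M (w₁ ++ v.reverse) *ᵥ β)) := by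
    rw [reverseTranspose, mulVec_transpose, neg_vecMul, dotProduct_neg, vecMul_vecMul, ← hMm,
      dotProduct_comm, dotProduct_mulVec]
  have h₁ : α ⬝ᵥ (M (w₁ ++ w₀) *ᵥ β) = α ⬝ᵥ (M w₁ *ᵥ β) := by
    have h := dotProduct_mulVec_eq_of_forall_le (reverseTranspose M)
      (by simp [reverseTranspose, hM0]) (reverseTranspose_append M hMm) β
      (vecMul_average_reverseTranspose M β hβA) (-(α ᵥ* M w₁)) (-(α ⬝ᵥ (M w₁ *ᵥ β)))
      (fun u => by rw [hdual]; exact neg_le_neg (hmin' _))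
      (by rw [dotProduct_neg, dotProduct_comm, dotProduct_mulVec]) w₀.reverse
    rw [hdual, List.reverse_reverse] at h
    exact neg_injective h
  have hid : α ⬝ᵥ (M [] *ᵥ β) = 1 := by rw [hM0, one_mulVec, hαβ]
  have := hmax' w
  have := hmin' w
  have := hmax' []
  have := hmin' []
  linarith

theorem dotProduct_mul_mulVec [Fintype Q] {κ : Type*} [Fintype κ]
    (C : Matrix Q κ ℝ) (R : Matrix κ Q ℝ)
    (α β : Q → ℝ) :
    α ⬝ᵥ ((C * R) *ᵥ β) = ∑ i, (α ⬝ᵥ fun p => C p i) * ((fun p => R i p) ⬝ᵥ β) := by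
  rw [← mulVec_mulVec, dotProduct_mulVec]
  rfl

theorem exists_rankUn_factorization [Fintype Q] (M : List σ → Matrix Q Q ℝ)
    (hUn : ∀ w i j, M w i j = 0 ∨ M w i j = 1) :
    ∃ w, ∃ C : Matrix Q (Fin (rankUn M)) ℝ, ∃ R : Matrix (Fin (rankUn M)) Q ℝ,
      (∀ i j, C i j = 0 ∨ C i j = 1) ∧ (∀ i j, R i j = 0 ∨ R i j = 1) ∧ M w = C * R := by
  classical
  obtain ⟨w, hw⟩ : rankUn M ∈ Set.range fun w => rankUnMat (M w) :=
    Nat.sInf_mem (Set.range_nonempty _)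
  refine ⟨w, ?_⟩
  rw [← hw]
  refine Nat.sInf_mem (s := {r : ℕ | ∃ C : Matrix Q (Fin r) ℝ, ∃ R : Matrix (Fin r) Q ℝ,
    (∀ i j, C i j = 0 ∨ C i j = 1) ∧ (∀ i j, R i j = 0 ∨ R i j = 1) ∧ M w = C * R}) ?_
  let e := Fintype.equivFin Q
  refine ⟨Fintype.card Q, (M w).submatrix id e.symm, (1 : Matrix Q Q ℝ).submatrix e.symm id,
    fun i j => hUn _ _ _, fun i j => ?_, ?_⟩
  · simp only [submatrix_apply, one_apply]
    split_ifs <;> simp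
  · rw [submatrix_mul_equiv]
    simp

theorem rankUn_le_card (M : List σ → Matrix Q Q ℝ) (w : List σ) {κ : Type*} [Fintype κ]
    (C : Matrix Q κ ℝ) (R : Matrix κ Q ℝ)
    (hC : ∀ i j, C i j = 0 ∨ C i j = 1) (hR : ∀ i j, R i j = 0 ∨ R i j = 1)
    (h : M w = C * R) : rankUn M ≤ Fintype.card κ := by
  let e := Fintype.equivFin κ
  have hrank : rankUnMat (M w) ≤ Fintype.card κ := by
    refine Nat.sInf_le ⟨C.submatrix id e.symm, R.submatrix e.symm id, fun i j => hC _ _,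
      fun i j => hR _ _, ?_⟩
    rw [submatrix_mul_equiv, h]
    rfl
  exact le_trans (Nat.sInf_le (Set.mem_range_self w)) hrank

/-- A column of a nonnegative factor `C` of `M w = C * R` weighs at most as much as a column of
`M`, provided the corresponding row of `R` is nonzero. -/
theorem dotProduct_factor_le [Fintype Q] (M : List σ → Matrix Q Q ℝ) (w : List σ)
    {κ : Type*} [Fintype κ]
    (C : Matrix Q κ ℝ) (R : Matrix κ Q ℝ)
    (hC : ∀ i j, C i j = 0 ∨ C i j = 1) (hR : ∀ i j, R i j = 0 ∨ R i j = 1)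
    (h : M w = C * R) (α : Q → ℝ) (hα : ∀ q, 0 < α q)
    (m : ℝ) (hm : ∀ y, IsCol M y → α ⬝ᵥ y ≤ m) (i : κ) (hi : (fun p => R i p) ≠ 0) :
    (α ⬝ᵥ fun p => C p i) ≤ m := by
  obtain ⟨q, hq⟩ := Function.ne_iff.1 hi
  have hq1 : R i q = 1 := (hR i q).resolve_left hq
  refine le_trans ?_ (hm _ ⟨w, q, rfl⟩)
  refine dotProduct_le_dotProduct_of_nonneg_left (fun p => ?_) fun p => (hα p).le
  rw [h, mul_apply]
  calc C p i = C p i * R i q := by rw [hq1, mul_one]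
    _ ≤ _ := Finset.single_le_sum (f := fun k => C p k * R k q)
      (fun k _ => by rcases hC p k with h | h <;> rcases hR k q with h' | h' <;> simp [h, h'])
      (Finset.mem_univ i)

end UFA


theorem rank_weight {Q σ : Type*} [Fintype Q] [DecidableEq Q] [Nonempty Q]
    [Fintype σ] [Nonempty σ]
    (M : List σ → Matrix Q Q ℝ)
    (hM0 : M [] = 1) (hMm : ∀ u v, M (u ++ v) = M u * M v)
    (hUn : ∀ w i j, M w i j = 0 ∨ M w i j = 1)
    (hComp : ∀ w, M w ≠ 0)
    (hSC : ∀ p q : Q, ∃ w, M w p q = 1)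
    (α β : Q → ℝ) (hα : ∀ q, 0 < α q) (hβ : ∀ q, 0 < β q)
    (hαA : α ᵥ* ((Fintype.card σ : ℝ)⁻¹ • ∑ a : σ, M [a]) = α)
    (hβA : ((Fintype.card σ : ℝ)⁻¹ • ∑ a : σ, M [a]) *ᵥ β = β)
    (hαβ : α ⬝ᵥ β = 1)
    (mcw : ℝ) (hmcw₁ : ∃ y, UFA.IsCol M y ∧ α ⬝ᵥ y = mcw)
    (hmcw₂ : ∀ y, UFA.IsCol M y → α ⬝ᵥ y ≤ mcw)
    (mrw : ℝ) (hmrw₁ : ∃ x, UFA.IsRow M x ∧ x ⬝ᵥ β = mrw)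
    (hmrw₂ : ∀ x, UFA.IsRow M x → x ⬝ᵥ β ≤ mrw)
 :
    (∀ w : List σ, α ⬝ᵥ (M w *ᵥ β) = 1) ∧
    (1 : ℝ) = (UFA.rankUn M : ℝ) * mcw * mrw := by
  have hone := UFA.dotProduct_mulVec_eq_one M hM0 hMm hUn α β hαA hβA hαβ
  refine ⟨hone, ?_⟩
  have hrow_le (x) (hx : UFA.IsCol (UFA.reverseTranspose M) x) : β ⬝ᵥ x ≤ mrw := by
    rw [dotProduct_comm]
    exact hmrw₂ x ((UFA.isCol_reverseTranspose_iff M x).1 hx)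
  obtain ⟨q₀⟩ := ‹Nonempty Q›
  have hcol_pos : 0 < mcw := by
    refine lt_of_lt_of_le (hα q₀) (le_of_eq_of_le ?_ (hmcw₂ _ ⟨[], q₀, rfl⟩))
    simp [hM0, dotProduct, one_apply]
  have hrow_pos : 0 < mrw := by
    refine lt_of_lt_of_le (hβ q₀) (le_of_eq_of_le ?_ (hmrw₂ _ ⟨[], q₀, rfl⟩))
    simp [hM0, dotProduct, one_apply]
  apply le_antisymm
  · obtain ⟨w, C, R, hC, hR, h⟩ := UFA.exists_rankUn_factorization M hUn
    have hT : UFA.reverseTranspose M w.reverse = Rᵀ * Cᵀ := by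
      rw [UFA.reverseTranspose, List.reverse_reverse, h, transpose_mul]
    rw [← hone w, h, UFA.dotProduct_mul_mulVec]
    calc _ ≤ ∑ _i : Fin (UFA.rankUn M), mcw * mrw := Finset.sum_le_sum fun i _ => ?_
      _ = _ := by simp [mul_assoc]
    by_cases hRi : (fun p => R i p) = 0
    · rw [hRi, zero_dotProduct, mul_zero]
      positivity
    by_cases hCi : (fun p => C p i) = 0
    · rw [hCi, dotProduct_zero, zero_mul]
      positivity
    refine mul_le_mul (UFA.dotProduct_factor_le M w C R hC hR h α hα mcw hmcw₂ i hRi) ?_ ?_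
      hcol_pos.le
    · rw [dotProduct_comm]
      exact UFA.dotProduct_factor_le (UFA.reverseTranspose M) w.reverse Rᵀ Cᵀ
        (fun i j => hR j i) (fun i j => hC j i) hT β hβ mrw hrow_le i hCi
    · refine dotProduct_nonneg_of_nonneg (fun p => ?_) fun p => (hβ p).le
      rcases hR i p with h | h <;> simp [h]
  · obtain ⟨u, hu⟩ := UFA.exists_forall_col_eq_zero_or_dotProduct_eq M hM0 hMm hUn hSC α hα hαA
      mcw hmcw₁ hmcw₂
    obtain ⟨v', hv'⟩ := UFA.exists_forall_col_eq_zero_or_dotProduct_eq (UFA.reverseTranspose M)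
      (by simp [UFA.reverseTranspose, hM0]) (UFA.reverseTranspose_append M hMm)
      (fun w i j => hUn _ _ _)
      (fun p q => (hSC q p).imp' List.reverse fun w hw => by simpa [UFA.reverseTranspose] using hw)
      β hβ (UFA.vecMul_average_reverseTranspose M β hβA) mrw
      (hmrw₁.imp fun x hx => ⟨(UFA.isCol_reverseTranspose_iff M x).2 hx.1,
        by rw [dotProduct_comm, hx.2]⟩) hrow_le
    obtain ⟨v, rfl⟩ : ∃ v : List σ, v.reverse = v' := ⟨_, List.reverse_reverse _⟩
    have hv (q : Q) : (fun p => M v q p) = 0 ∨ (fun p => M v q p) ⬝ᵥ β = mrw := by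
      simpa [UFA.reverseTranspose, dotProduct_comm β] using hv' q
    classical
    let P (q : Q) : Prop := (fun p => M u p q) ≠ 0 ∧ (fun p => M v q p) ≠ 0
    have hfac : M (u ++ v) = (M u).submatrix id (Subtype.val : {q // P q} → Q) *
        (M v).submatrix (Subtype.val : {q // P q} → Q) id := by
      ext i j
      simp only [hMm, mul_apply, submatrix_apply, id_eq]
      refine (Fintype.sum_of_injective Subtype.val Subtype.val_injective _ _ (fun q hq => ?_)
        fun _ => rfl).symm
      by_contra hne
      refine hq ⟨⟨q, fun h => hne ?_, fun h => hne ?_⟩, rfl⟩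
      · rw [show M u i q = 0 from congrFun h i, zero_mul]
      · rw [show M v q j = 0 from congrFun h j, mul_zero]
    have hle := UFA.rankUn_le_card M (u ++ v) _ _ (fun i j => hUn _ _ _) (fun i j => hUn _ _ _) hfac
    have hval := hone (u ++ v)
    rw [hfac, UFA.dotProduct_mul_mulVec] at hval
    calc (UFA.rankUn M : ℝ) * mcw * mrw ≤ (Fintype.card {q // P q} : ℝ) * mcw * mrw := by gcongr
      _ = ∑ _q : {q // P q}, mcw * mrw := by simp [mul_assoc]
      _ = 1 := by
        rw [← hval]
        refine Finset.sum_congr rfl fun q _ => ?_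
        exact congrArg₂ (· * ·) ((hu q).resolve_left q.2.1).symm
          ((hv q).resolve_left q.2.2).symm
end

section
/- rank_un(M) ≤ dim span(MCol), i.e., the minimum unambiguous rank of M is at most the dimension of the real vector space spanned by the set of all maximal columns. -/
open Matrix

section FiniteMonoid

theorem exists_isIdempotentElem_pow_succ {α : Type*} [Monoid α] [Finite α] (a : α) :
    ∃ n : ℕ, IsIdempotentElem (a ^ (n + 1)) := by
  obtain ⟨m, n, hne, h⟩ := Finite.exists_ne_map_eq_of_infinite (fun k : ℕ => a ^ k)
  wlog hlt : m < n generalizing m n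
  · exact this n m hne.symm h.symm (by omega)
  obtain ⟨d, rfl⟩ := Nat.exists_eq_add_of_lt hlt
  have shift : ∀ j c : ℕ, a ^ (m + j + c * (d + 1)) = a ^ (m + j) := by
    intro j c
    induction c with
    | zero => simp
    | succ c ih =>
      have : m + j + (c + 1) * (d + 1) = (m + d + 1) + (j + c * (d + 1)) := by ring
      rw [this, pow_add, ← h, ← pow_add, ← add_assoc, ih]
  refine ⟨m * (d + 1) + d, ?_⟩
  have key := shift (m * d + d + 1) (m + 1)
  unfold IsIdempotentElem
  rw [← pow_add]
  convert key using 2 <;> ring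

/-- A finite monoid has an idempotent `e` such that the local monoid at `e` is a group. -/
theorem exists_isIdempotentElem_local_inverse (α : Type*) [Monoid α] [Finite α] :
    ∃ e : α, IsIdempotentElem e ∧
      ∀ x, ∃ y, e * x * e * y = e ∧ y * (e * x * e) = e ∧ y * e = y := by
  obtain ⟨e, he, hmin⟩ := exists_minimalFor_of_wellFoundedLT
    (fun e : α => IsIdempotentElem e) (fun e => (Set.range fun x => e * x * e).ncard)
    ⟨1, IsIdempotentElem.one⟩
  have primitive : ∀ f : α, IsIdempotentElem f → e * f = f → f * e = f → f = e := by
    intro f hf hef hfe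
    have hsub : (Set.range fun x => f * x * f) ⊆ Set.range fun x => e * x * e := by
      rintro _ ⟨x, rfl⟩
      refine ⟨f * x * f, ?_⟩
      simp only [mul_assoc, hfe]
      rw [← mul_assoc, hef]
    have heq := Set.eq_of_subset_of_ncard_le hsub
      (hmin hf (Set.ncard_le_ncard hsub (Set.toFinite _))) (Set.toFinite _)
    have hmem : e ∈ Set.range fun x => f * x * f := by
      rw [heq]
      exact ⟨1, by simp [he.eq]⟩
    obtain ⟨x, hx⟩ := hmem
    simp only at hx
    rw [← hfe, ← hx]
    simp only [← mul_assoc, hf.eq]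
  refine ⟨e, he, fun x => ?_⟩
  set g := e * x * e with hg
  have heg : e * g = g := by rw [hg]; simp only [← mul_assoc, he.eq]
  have hge : g * e = g := by rw [hg, mul_assoc, he.eq]
  obtain ⟨n, hn⟩ := exists_isIdempotentElem_pow_succ g
  have hpow : g ^ (n + 1) = e := by
    refine primitive _ hn ?_ ?_
    · rw [pow_succ', ← mul_assoc, heg]
    · rw [pow_succ, mul_assoc, hge]
  refine ⟨g ^ n * e, ?_, ?_, ?_⟩
  · rw [← mul_assoc, ← pow_succ', hpow, he.eq]
  · rw [mul_assoc, heg, ← pow_succ, hpow]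
  · rw [mul_assoc, he.eq]

end FiniteMonoid

section ZeroOneMonoid

variable {Q : Type*} [Fintype Q] [DecidableEq Q] {S : Submonoid (Matrix Q Q ℝ)}

theorem finite_of_zero_one (hS : ∀ A ∈ S, ∀ i j, A i j = 0 ∨ A i j = 1) : Finite S := by
  have : {A : Q → Q → ℝ | ∀ i, A i ∈ {v : Q → ℝ | ∀ j, v j ∈ ({0, 1} : Set ℝ)}}.Finite :=
    Set.Finite.pi' fun _ => Set.Finite.pi' fun _ => Set.toFinite _
  exact (this.subset fun A hA => hS A hA).to_subtype

theorem mul_apply_eq_one (hS : ∀ A ∈ S, ∀ i j, A i j = 0 ∨ A i j = 1)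
    {A B : Matrix Q Q ℝ} (hA : A ∈ S) (hB : B ∈ S) {p q r : Q}
    (hpq : A p q = 1) (hqr : B q r = 1) : (A * B) p r = 1 := by
  refine (hS _ (S.mul_mem hA hB) p r).resolve_left fun h0 => ?_
  have hnn : ∀ t ∈ Finset.univ, 0 ≤ A p t * B t r := fun t _ => by
    rcases hS A hA p t with h | h <;> rcases hS B hB t r with h' | h' <;> simp [h, h']
  rw [Matrix.mul_apply] at h0
  have := (Finset.sum_eq_zero_iff_of_nonneg hnn).1 h0 q (Finset.mem_univ q)
  simp [hpq, hqr] at this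

theorem exists_of_mul_apply_eq_one (hS : ∀ A ∈ S, ∀ i j, A i j = 0 ∨ A i j = 1)
    {A B : Matrix Q Q ℝ} (hA : A ∈ S) (hB : B ∈ S) {p r : Q}
    (h : (A * B) p r = 1) : ∃ q, A p q = 1 ∧ B q r = 1 := by
  by_contra! hne
  rw [Matrix.mul_apply, Finset.sum_eq_zero] at h
  · exact zero_ne_one h
  intro q _
  rcases hS A hA p q with h0 | h1
  · simp [h0]
  · simp [(hS B hB q r).resolve_right (hne q h1)]

theorem eq_of_mul_apply (hS : ∀ A ∈ S, ∀ i j, A i j = 0 ∨ A i j = 1)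
    {A B : Matrix Q Q ℝ} (hA : A ∈ S) (hB : B ∈ S) {p q q' r : Q}
    (hpq : A p q = 1) (hqr : B q r = 1) (hpq' : A p q' = 1) (hqr' : B q' r = 1) : q = q' := by
  by_contra hne
  have hnn : ∀ t ∈ Finset.univ, t ∉ ({q, q'} : Finset Q) → 0 ≤ A p t * B t r := fun t _ _ => by
    rcases hS A hA p t with h | h <;> rcases hS B hB t r with h' | h' <;> simp [h, h']
  have hle := Finset.sum_le_sum_of_subset_of_nonneg
    (Finset.subset_univ ({q, q'} : Finset Q)) hnn
  rw [Finset.sum_pair hne, hpq, hqr, hpq', hqr', ← Matrix.mul_apply] at hle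
  rcases hS _ (S.mul_mem hA hB) p r with h | h <;> rw [h] at hle <;> norm_num at hle

variable {e : Matrix Q Q ℝ}

theorem exists_fixed_between (hS : ∀ A ∈ S, ∀ i j, A i j = 0 ∨ A i j = 1)
    (he : e ∈ S) (hee : e * e = e) {p q : Q} (h : e p q = 1) :
    ∃ t, e t t = 1 ∧ e p t = 1 ∧ e t q = 1 := by
  obtain ⟨t, hpt, htq⟩ := exists_of_mul_apply_eq_one hS he he (hee.symm ▸ h)
  obtain ⟨t', hpt', htt'⟩ := exists_of_mul_apply_eq_one hS he he (hee.symm ▸ hpt)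
  have h' : e t' q = 1 := hee ▸ mul_apply_eq_one hS he he htt' htq
  obtain rfl := eq_of_mul_apply hS he he hpt htq hpt' h'
  exact ⟨t, htt', hpt, htq⟩

theorem eq_of_fixed (hS : ∀ A ∈ S, ∀ i j, A i j = 0 ∨ A i j = 1)
    (he : e ∈ S) {t t' : Q} (ht : e t t = 1) (ht' : e t' t' = 1)
    (h : e t t' = 1) : t = t' :=
  eq_of_mul_apply hS he he ht h h ht'

/-- The rows of an element of the minimal ideal indexed by fixed states are disjoint. -/
theorem eq_of_fixed_rows_meet (hS : ∀ A ∈ S, ∀ i j, A i j = 0 ∨ A i j = 1)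
    (hSC : ∀ p q, ∃ A ∈ S, A p q = 1)
    (he : e ∈ S) (hee : e * e = e)
    (hinv : ∀ A ∈ S, ∃ B ∈ S, e * A * e * B = e ∧ B * (e * A * e) = e ∧ B * e = B)
    {A : Matrix Q Q ℝ} (hA : A ∈ S) {t₁ t₂ s : Q} (h₁ : e t₁ t₁ = 1) (h₂ : e t₂ t₂ = 1)
    (hs₁ : (e * A) t₁ s = 1) (hs₂ : (e * A) t₂ s = 1) : t₁ = t₂ := by
  obtain ⟨Z, hZ, hst⟩ := hSC s t₁
  obtain ⟨B, hB, hr, hl, hBe⟩ := hinv (A * Z) (S.mul_mem hA hZ)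
  set g := e * (A * Z) * e with hg
  have hgS : g ∈ S := S.mul_mem (S.mul_mem he (S.mul_mem hA hZ)) he
  have hmul : ∀ t, (e * A) t s = 1 → g t t₁ = 1 := fun t h => by
    rw [hg, ← mul_assoc]
    exact mul_apply_eq_one hS (S.mul_mem (S.mul_mem he hA) hZ) he
      (mul_apply_eq_one hS (S.mul_mem he hA) hZ h hst) h₁
  obtain ⟨x, hx, -⟩ := exists_of_mul_apply_eq_one hS hB hgS (hl.symm ▸ h₁)
  obtain ⟨y, hy, hyx⟩ := exists_of_mul_apply_eq_one hS hB he (hBe.symm ▸ hx)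
  obtain ⟨t, ht, hyt, -⟩ := exists_fixed_between hS he hee hyx
  have hBt : B t₁ t = 1 := hBe ▸ mul_apply_eq_one hS hB he hy hyt
  have het : ∀ t', (e * A) t' s = 1 → e t' t = 1 := fun t' h =>
    hr ▸ mul_apply_eq_one hS hgS hB (hmul t' h) hBt
  rw [eq_of_fixed hS he h₁ ht (het _ hs₁), eq_of_fixed hS he h₂ ht (het _ hs₂)]

/-- A column of an idempotent of the minimal ideal at a fixed state is maximal. -/
theorem fixed_col_maximal (hS : ∀ A ∈ S, ∀ i j, A i j = 0 ∨ A i j = 1)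
    (hSC : ∀ p q, ∃ A ∈ S, A p q = 1)
    (he : e ∈ S) (hee : e * e = e)
    (hinv : ∀ A ∈ S, ∃ B ∈ S, e * A * e * B = e ∧ B * (e * A * e) = e ∧ B * e = B)
    {A : Matrix Q Q ℝ} (hA : A ∈ S) {t s : Q} (ht : e t t = 1)
    (hle : ∀ p, e p t = 1 → A p s = 1) {p : Q} (hp : A p s = 1) : e p t = 1 := by
  obtain ⟨U, hU, htp⟩ := hSC t p
  have heU := S.mul_mem he hU
  have hN : (e * U) t p = 1 := mul_apply_eq_one hS he hU ht htp
  obtain ⟨B, hB, -, hl, -⟩ := hinv U hU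
  obtain ⟨x, -, hx⟩ := exists_of_mul_apply_eq_one hS hB (S.mul_mem heU he) (hl.symm ▸ ht)
  obtain ⟨p', hxp', hp't⟩ := exists_of_mul_apply_eq_one hS heU he hx
  obtain ⟨y, hxy, hyp'⟩ := exists_of_mul_apply_eq_one hS he hU hxp'
  obtain ⟨n, hn, -, hny⟩ := exists_fixed_between hS he hee hxy
  have hnp' : (e * U) n p' = 1 := mul_apply_eq_one hS he hU hny hyp'
  have hn_s : (e * (U * A)) n s = 1 :=
    mul_assoc e U A ▸ mul_apply_eq_one hS heU hA hnp' (hle p' hp't)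
  have ht_s : (e * (U * A)) t s = 1 := mul_assoc e U A ▸ mul_apply_eq_one hS heU hA hN hp
  obtain rfl := eq_of_fixed_rows_meet hS hSC he hee hinv (S.mul_mem hU hA) hn ht hn_s ht_s
  rw [eq_of_mul_apply hS heU hA hN hp hnp' (hle p' hp't)]
  exact hp't

theorem rankUnMat_le_card_fixed (hS : ∀ A ∈ S, ∀ i j, A i j = 0 ∨ A i j = 1)
    (he : e ∈ S) (hee : e * e = e) :
    UFA.rankUnMat e ≤ Nat.card {t // e t t = 1} := by
  have φ : Fin (Nat.card {t // e t t = 1}) ≃ {t // e t t = 1} := (Finite.equivFin _).symm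
  refine Nat.sInf_le ⟨.of fun p i => e p (φ i), .of fun i q => e (φ i) q, fun p i => hS e he p _,
    fun i q => hS e he _ q, ?_⟩
  ext p q
  simp only [Matrix.mul_apply, Matrix.of_apply]
  rcases hS e he p q with h0 | h1
  · rw [h0, Finset.sum_eq_zero]
    intro i _
    rcases hS e he p (φ i) with h | h
    · simp [h]
    rcases hS e he (φ i) q with h' | h'
    · simp [h']
    have := mul_apply_eq_one hS he he h h'
    rw [hee, h0] at this
    exact absurd this zero_ne_one
  · obtain ⟨t, ht, hpt, htq⟩ := exists_fixed_between hS he hee h1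
    rw [Finset.sum_eq_single (φ.symm ⟨t, ht⟩)]
    · simp [h1, hpt, htq]
    · intro i _ hi
      rcases hS e he p (φ i) with h | h
      · simp [h]
      rcases hS e he (φ i) q with h' | h'
      · simp [h']
      refine absurd ?_ hi
      rw [Equiv.eq_symm_apply]
      exact Subtype.ext (eq_of_mul_apply hS he he h h' hpt htq)
    · simp

theorem linearIndependent_fixed_cols (hS : ∀ A ∈ S, ∀ i j, A i j = 0 ∨ A i j = 1)
    (he : e ∈ S) :
    LinearIndependent ℝ fun (t : {t // e t t = 1}) (p : Q) => e p t := by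
  classical
  rw [Fintype.linearIndependent_iff]
  intro g hg t
  have h := congrFun hg t
  rw [Finset.sum_apply, Finset.sum_eq_single t] at h
  · simpa [t.2] using h
  · intro t' _ hne
    have : e t t' = 0 := (hS e he t t').resolve_right fun h1 =>
      hne (Subtype.ext (eq_of_fixed hS he t.2 t'.2 h1)).symm
    simp [this]
  · simp

end ZeroOneMonoid

theorem rank_le_dim_span_maxCol {Q σ : Type*} [Fintype Q] [DecidableEq Q] [Nonempty Q]
    [Fintype σ] [Nonempty σ]
    (M : List σ → Matrix Q Q ℝ)
    (hM0 : M [] = 1) (hMm : ∀ u v, M (u ++ v) = M u * M v)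
    (hUn : ∀ w i j, M w i j = 0 ∨ M w i j = 1)
    (hComp : ∀ w, M w ≠ 0)
    (hSC : ∀ p q : Q, ∃ w, M w p q = 1)
 :
    UFA.rankUn M ≤ Module.finrank ℝ (Submodule.span ℝ {y : Q → ℝ | UFA.IsMaxCol M y}) := by
  classical
  let S : Submonoid (Matrix Q Q ℝ) :=
    { carrier := Set.range M
      one_mem' := ⟨[], hM0⟩
      mul_mem' := by
        rintro _ _ ⟨u, rfl⟩ ⟨v, rfl⟩
        exact ⟨u ++ v, hMm u v⟩ }
  have hS : ∀ A ∈ S, ∀ i j, A i j = 0 ∨ A i j = 1 := by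
    rintro _ ⟨w, rfl⟩
    exact hUn w
  have hSC' : ∀ p q, ∃ A ∈ S, A p q = 1 := fun p q =>
    let ⟨w, hw⟩ := hSC p q
    ⟨M w, ⟨w, rfl⟩, hw⟩
  have := finite_of_zero_one hS
  obtain ⟨⟨e, he⟩, hidem, hloc⟩ := exists_isIdempotentElem_local_inverse S
  have hee : e * e = e := congrArg Subtype.val hidem.eq
  have hinv : ∀ A ∈ S, ∃ B ∈ S, e * A * e * B = e ∧ B * (e * A * e) = e ∧ B * e = B := by
    intro A hA
    obtain ⟨⟨B, hB⟩, h₁, h₂, h₃⟩ := hloc ⟨A, hA⟩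
    exact ⟨B, hB, congrArg Subtype.val h₁, congrArg Subtype.val h₂, congrArg Subtype.val h₃⟩
  obtain ⟨w, rfl⟩ := id he
  have hmax : ∀ t : {t // M w t t = 1}, UFA.IsMaxCol M fun p => M w p t := by
    rintro ⟨t, ht⟩
    refine ⟨⟨w, t, rfl⟩, ?_⟩
    rintro _ ⟨v, s, rfl⟩ hle
    have hle' : ∀ p, M w p t = 1 → M v p s = 1 := fun p hp =>
      (hUn v p s).resolve_left fun h0 => by
        have := hle p
        simp only [hp, h0] at this
        norm_num at this
    funext p
    rcases hUn v p s with h0 | h1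
    · rw [h0]
      exact ((hUn w p t).resolve_right fun h => by
        rw [hle' p h] at h0
        exact one_ne_zero h0).symm
    · rw [h1]
      exact (fixed_col_maximal hS hSC' he hee hinv ⟨v, rfl⟩ ht hle' h1).symm
  calc UFA.rankUn M ≤ UFA.rankUnMat (M w) := Nat.sInf_le ⟨w, rfl⟩
    _ ≤ Nat.card {t // M w t t = 1} := rankUnMat_le_card_fixed hS he hee
    _ = Module.finrank ℝ (Submodule.span ℝ
          (Set.range fun (t : {t // M w t t = 1}) (p : Q) => M w p t)) := by
      rw [finrank_span_eq_card (linearIndependent_fixed_cols hS he), Nat.card_eq_fintype_card]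
    _ ≤ _ := Submodule.finrank_mono (Submodule.span_mono (by
      rintro _ ⟨t, rfl⟩
      exact hmax t))
end

section
/- Let v ∈ Σ* and q ∈ Q be such that M(v)[q] is a maximal column. Then for every q' ∈ Mer(q) with q' ≠ q, the vector M(v)[q'] is the zero vector. -/
open Matrix

theorem maxCol_kills_mergeable {Q σ : Type*} [Fintype Q] [DecidableEq Q] [Nonempty Q]
    [Fintype σ] [Nonempty σ]
    (M : List σ → Matrix Q Q ℝ)
    (hM0 : M [] = 1) (hMm : ∀ u v, M (u ++ v) = M u * M v)
    (hUn : ∀ w i j, M w i j = 0 ∨ M w i j = 1)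
    (hComp : ∀ w, M w ≠ 0)
    (hSC : ∀ p q : Q, ∃ w, M w p q = 1)
    (v : List σ) (q : Q) (h : UFA.IsMaxCol M (fun p => M v p q)) :
    ∀ q' ∈ UFA.Mer M q, q' ≠ q → (fun p => M v p q') = (0 : Q → ℝ) := by
  rintro q' ⟨S, hqS, hq'S, w, s, hS⟩ hne
  have hw : ∀ r ∈ S, M w r s = 1 := fun r hr => by
    have := congrFun hS r
    simpa [ind, hr] using this.symm
  have hnonneg : ∀ u i j, 0 ≤ M u i j := fun u i j => by
    rcases hUn u i j with h | h <;> simp [h]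
  have hsum : ∀ p, M v p q + M v p q' ≤ M (v ++ w) p s := fun p => by
    rw [hMm, Matrix.mul_apply]
    calc M v p q + M v p q' = ∑ r ∈ {q, q'}, M v p r * M w r s := by
          rw [Finset.sum_pair hne.symm, hw q hqS, hw q' hq'S, mul_one, mul_one]
      _ ≤ ∑ r, M v p r * M w r s :=
          Finset.sum_le_univ_sum_of_nonneg fun r => mul_nonneg (hnonneg v p r) (hnonneg w r s)
  have hmax := h.2 (fun p => M (v ++ w) p s) ⟨v ++ w, s, rfl⟩ fun p =>
    (le_add_of_nonneg_right (hnonneg v p q')).trans (hsum p)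
  funext p
  have hp : M (v ++ w) p s = M v p q := congrFun hmax p
  exact le_antisymm (by simpa [hp] using hsum p) (hnonneg v p q')
end

section
/- Let y be a maximal pseudo-column. Then α^T y = mcw. -/
open Matrix

namespace UFA

variable {Q σ : Type*} [Fintype Q]

/-- Strong connectivity makes every state carry a column of maximum weight. -/
theorem exists_word_maxWeight (M : List σ → Matrix Q Q ℝ)
    (hMm : ∀ u v, M (u ++ v) = M u * M v) (hM : ∀ w i j, 0 ≤ M w i j)
    (hSC : ∀ p q : Q, ∃ w, M w p q = 1) (α : Q → ℝ) (hα : ∀ q, 0 ≤ α q) (mcw : ℝ)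
    (hmcw : ∃ y, IsCol M y ∧ α ⬝ᵥ y = mcw) (q : Q) :
    ∃ w, mcw ≤ (α ᵥ* M w) q := by
  obtain ⟨_, ⟨x, t, rfl⟩, rfl⟩ := hmcw
  obtain ⟨r, hr⟩ := hSC t q
  refine ⟨x ++ r, Finset.sum_le_sum fun p _ => mul_le_mul_of_nonneg_left ?_ (hα p)⟩
  change M x p t ≤ M (x ++ r) p q
  rw [hMm, Matrix.mul_apply]
  calc M x p t = M x p t * M r t q := by rw [hr, mul_one]
    _ ≤ ∑ j, M x p j * M r j q :=
      Finset.single_le_sum (f := fun j => M x p j * M r j q)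
        (fun j _ => mul_nonneg (hM _ _ _) (hM _ _ _)) (Finset.mem_univ t)

/-- If the column of `w` at `q` has maximum weight, then the columns of `w` at states other than
`q` that share a column with `q` have weight zero. -/
theorem weight_eq_zero_of_mem_Mer [DecidableEq Q] (M : List σ → Matrix Q Q ℝ)
    (hMm : ∀ u v, M (u ++ v) = M u * M v) (hM : ∀ w i j, 0 ≤ M w i j)
    (α : Q → ℝ) (hα : ∀ q, 0 ≤ α q) (mcw : ℝ) (hmcw : ∀ y, IsCol M y → α ⬝ᵥ y ≤ mcw)
    {w : List σ} {q q' : Q} (hw : mcw ≤ (α ᵥ* M w) q) (hq' : q' ∈ Mer M q) (hne : q' ≠ q) :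
    (α ᵥ* M w) q' = 0 := by
  have hnonneg : ∀ p, 0 ≤ (α ᵥ* M w) p := fun p =>
    Finset.sum_nonneg fun i _ => mul_nonneg (hα i) (hM _ _ _)
  obtain ⟨S, hqS, hqS', u, s, hu⟩ := hq'
  have hcol : (fun p => M (w ++ u) p s) = M w *ᵥ ind S := by
    funext p
    rw [hMm, Matrix.mul_apply, hu]
    rfl
  have hle : (α ᵥ* M w) ⬝ᵥ ind S ≤ mcw := by
    rw [← Matrix.dotProduct_mulVec, ← hcol]
    exact hmcw _ ⟨w ++ u, s, rfl⟩
  have hpair : (α ᵥ* M w) q + (α ᵥ* M w) q' ≤ (α ᵥ* M w) ⬝ᵥ ind S := by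
    have h := Finset.sum_le_univ_sum_of_nonneg (s := {q, q'})
      (f := fun p => (α ᵥ* M w) p * ind S p) fun p =>
        mul_nonneg (hnonneg p) (Set.indicator_nonneg (fun _ _ => zero_le_one) p)
    rw [Finset.sum_pair hne.symm] at h
    simpa [ind, hqS, hqS', dotProduct] using h
  linarith [hnonneg q']

end UFA


theorem pseudo_column_weight {Q σ : Type*} [Fintype Q] [DecidableEq Q] [Nonempty Q]
    [Fintype σ] [Nonempty σ]
    (M : List σ → Matrix Q Q ℝ)
    (hM0 : M [] = 1) (hMm : ∀ u v, M (u ++ v) = M u * M v)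
    (hUn : ∀ w i j, M w i j = 0 ∨ M w i j = 1)
    (hComp : ∀ w, M w ≠ 0)
    (hSC : ∀ p q : Q, ∃ w, M w p q = 1)
    (α β : Q → ℝ) (hα : ∀ q, 0 < α q) (hβ : ∀ q, 0 < β q)
    (hαA : α ᵥ* ((Fintype.card σ : ℝ)⁻¹ • ∑ a : σ, M [a]) = α)
    (hβA : ((Fintype.card σ : ℝ)⁻¹ • ∑ a : σ, M [a]) *ᵥ β = β)
    (hαβ : α ⬝ᵥ β = 1)
    (mcw : ℝ) (hmcw₁ : ∃ y, UFA.IsCol M y ∧ α ⬝ᵥ y = mcw)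
    (hmcw₂ : ∀ y, UFA.IsCol M y → α ⬝ᵥ y ≤ mcw)
    (y : Q → ℝ)
    (hyU : ∀ w : List σ, α ⬝ᵥ (M w *ᵥ y) = α ⬝ᵥ y)
    (hyq : ∃ q : Q, y q = 1 ∧ ∀ q' ∉ UFA.Mer M q, y q' = 0) :
    α ⬝ᵥ y = mcw := by
  have hM : ∀ w i j, 0 ≤ M w i j := fun w i j => by
    rcases hUn w i j with h | h <;> simp [h]
  obtain ⟨q, hq, hsupp⟩ := hyq
  have hα' : ∀ q, 0 ≤ α q := fun q => (hα q).le
  obtain ⟨w, hw⟩ := UFA.exists_word_maxWeight M hMm hM hSC α hα' mcw hmcw₁ q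
  rw [← hyU w, Matrix.dotProduct_mulVec, dotProduct, Finset.sum_eq_single q, hq, mul_one]
  · exact le_antisymm (hmcw₂ _ ⟨w, q, rfl⟩) hw
  · intro q' _ hne
    by_cases hq' : q' ∈ UFA.Mer M q
    · rw [UFA.weight_eq_zero_of_mem_Mer M hMm hM α hα' mcw hmcw₂ hw hq' hne, zero_mul]
    · rw [hsupp q' hq', mul_zero]
  · simp
end
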